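/- arXiv:1706.09456 — 8 statements merged into one kernel-verified Lean document; each statement's English description precedes it below -/
import Mathlib

section
/- Let θ ∈ ℝ with 0 < θ < π, let n be a natural number, and suppose (aₘ) is a sequence of real numbers and ε > 0 is such that for all real z with |z| < ε one has Σ_{m} aₘ zᵐ = 1/(√(1−2z·cos θ+z²)·(1−z)) (the series converging absolutely and √ denoting the positive real square root; note 1−2z·cos θ+z² > 0 for |z| < 1). Then aₙ = 1/(2 sin(θ/2)) − (1/(2√2·π))·∫_θ^{2π−θ} cos((n+1)t)/(√(cos θ − cos t)·sin(t/2)) dt. -/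
open Real intervalIntegral

theorem integral_inv_sq_mul_cos_sq_add_sq_mul_sin_sq {p q : ℝ} (hp : 0 < p) (hq : 0 < q) :
    ∫ x in (-(π / 2))..(π / 2), 1 / (p ^ 2 * cos x ^ 2 + q ^ 2 * sin x ^ 2) = π / (p * q) := by
  have hpos : ∀ x : ℝ, 0 < p ^ 2 * cos x ^ 2 + q ^ 2 * sin x ^ 2 := by
    intro x
    rcases eq_or_ne (cos x) 0 with h | h
    · have := sin_sq_add_cos_sq x
      rw [h] at this ⊢
      have h1 : sin x ^ 2 = 1 := by linarith
      rw [h1]; positivity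
    · positivity
  have hqp : 0 < q / p := div_pos hq hp
  rw [intervalIntegral.integral_eq_sub_of_hasDerivAt_of_tendsto
    (f := fun x => arctan (q / p * tan x) / (p * q))
    (fa := -(π / 2) / (p * q)) (fb := π / 2 / (p * q))]
  · field_simp; ring
  · linarith [pi_pos]
  · intro x hx
    have hc : cos x ≠ 0 := (cos_pos_of_mem_Ioo hx).ne'
    have h := (((hasDerivAt_tan hc).const_mul (q / p)).arctan).div_const (p * q)
    refine h.congr_deriv ?_
    have := (hpos x).ne'
    rw [tan_eq_sin_div_cos]
    have h2 : 1 + (q / p * (sin x / cos x)) ^ 2 =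
        (p ^ 2 * cos x ^ 2 + q ^ 2 * sin x ^ 2) / (p ^ 2 * cos x ^ 2) := by
      field_simp
    rw [h2]
    field_simp
  · apply Continuous.intervalIntegrable
    exact continuous_const.div (by fun_prop) fun x => (hpos x).ne'
  · exact ((tendsto_arctan_atBot.mono_right nhdsWithin_le_nhds).comp
      (tendsto_tan_neg_pi_div_two.const_mul_atBot hqp)).div_const _
  · exact ((tendsto_arctan_atTop.mono_right nhdsWithin_le_nhds).comp
      (tendsto_tan_pi_div_two.const_mul_atTop hqp)).div_const _

theorem image_two_mul_arccos_cos_mul_sin {θ : ℝ} (hθ : 0 < θ) (hθ' : θ < π) :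
    (fun x => 2 * arccos (cos (θ / 2) * sin x)) '' Set.Ioo (-(π / 2)) (π / 2) =
      Set.Ioo θ (2 * π - θ) := by
  have hC : 0 < cos (θ / 2) := cos_pos_of_mem_Ioo ⟨by linarith, by linarith⟩
  have hcos : arccos (cos (θ / 2)) = θ / 2 := arccos_cos (by linarith) (by linarith)
  have hcos' : arccos (-cos (θ / 2)) = π - θ / 2 := by rw [arccos_neg, hcos]
  have hC1 : cos (θ / 2) ≤ 1 := cos_le_one _
  ext t
  constructor
  · rintro ⟨x, hx, rfl⟩
    have hs1 : sin x < 1 := by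
      have := strictMonoOn_sin ⟨hx.1.le, hx.2.le⟩ ⟨by linarith [pi_pos], le_rfl⟩ hx.2
      simpa using this
    have hs2 : -1 < sin x := by
      have := strictMonoOn_sin ⟨le_rfl, by linarith [pi_pos]⟩ ⟨hx.1.le, hx.2.le⟩ hx.1
      simpa using this
    have h1 : cos (θ / 2) * sin x < cos (θ / 2) := by nlinarith
    have h2 : -cos (θ / 2) < cos (θ / 2) * sin x := by nlinarith
    have h3 := strictAntiOn_arccos (⟨by linarith, by linarith⟩ : _ ∈ Set.Icc (-1 : ℝ) 1)
      ⟨by linarith, hC1⟩ h1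
    have h4 := strictAntiOn_arccos (⟨by linarith, by linarith⟩ : _ ∈ Set.Icc (-1 : ℝ) 1)
      ⟨by linarith, by linarith⟩ h2
    rw [hcos] at h3
    rw [hcos'] at h4
    constructor <;> dsimp only <;> linarith
  · rintro ⟨h1, h2⟩
    have h3 : cos (t / 2) < cos (θ / 2) :=
      cos_lt_cos_of_nonneg_of_le_pi (by linarith) (by linarith) (by linarith)
    have h4 : -cos (θ / 2) < cos (t / 2) := by
      rw [← cos_pi_sub]
      exact cos_lt_cos_of_nonneg_of_le_pi (by linarith) (by linarith) (by linarith)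
    have h5 : cos (t / 2) / cos (θ / 2) < 1 := by rwa [div_lt_one hC]
    have h6 : -1 < cos (t / 2) / cos (θ / 2) := by rw [lt_div_iff₀ hC]; linarith
    refine ⟨arcsin (cos (t / 2) / cos (θ / 2)), ⟨?_, ?_⟩, ?_⟩
    · exact neg_pi_div_two_lt_arcsin.2 h6
    · exact arcsin_lt_pi_div_two.2 h5
    · dsimp only
      rw [sin_arcsin h6.le h5.le, mul_div_cancel₀ _ hC.ne', arccos_cos (by linarith) (by linarith)]
      ring

theorem integral_div_sqrt_cos_sub_cos_mul_sin_half {θ : ℝ} (hθ : 0 < θ) (hθ' : θ < π)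
    (g : ℝ → ℝ) :
    ∫ t in θ..(2 * π - θ), g t / (√(cos θ - cos t) * sin (t / 2)) =
      √2 * ∫ x in (-(π / 2))..(π / 2),
        g (2 * arccos (cos (θ / 2) * sin x)) / (1 - cos (θ / 2) ^ 2 * sin x ^ 2) := by
  have hC : 0 < cos (θ / 2) := cos_pos_of_mem_Ioo ⟨by linarith, by linarith⟩
  have hC1 : cos (θ / 2) < 1 := by
    have := cos_lt_cos_of_nonneg_of_le_pi le_rfl (by linarith) (by linarith : 0 < θ / 2)
    simpa using this
  have hbd : ∀ x, -1 < cos (θ / 2) * sin x ∧ cos (θ / 2) * sin x < 1 := fun x => by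
    have h1 := sin_le_one x
    have h2 := neg_one_le_sin x
    constructor <;> nlinarith
  have hpos : ∀ x, 0 < 1 - (cos (θ / 2) * sin x) ^ 2 := fun x => by
    nlinarith [hbd x]
  rw [intervalIntegral.integral_of_le (by linarith), intervalIntegral.integral_of_le
    (by linarith [pi_pos]), MeasureTheory.integral_Ioc_eq_integral_Ioo,
    MeasureTheory.integral_Ioc_eq_integral_Ioo, ← image_two_mul_arccos_cos_mul_sin hθ hθ',
    MeasureTheory.integral_image_eq_integral_abs_deriv_smul (f' := fun x =>
      2 * (-(1 / √(1 - (cos (θ / 2) * sin x) ^ 2)) * (cos (θ / 2) * cos x))) measurableSet_Ioo,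
    ← MeasureTheory.integral_const_mul]
  · refine MeasureTheory.setIntegral_congr_fun measurableSet_Ioo fun x hx => ?_
    have hc : 0 < cos x := cos_pos_of_mem_Ioo hx
    have hsq : 0 < √(1 - (cos (θ / 2) * sin x) ^ 2) := sqrt_pos.2 (hpos x)
    have hss := sq_sqrt (hpos x).le
    have hroot : √(cos θ - cos (2 * arccos (cos (θ / 2) * sin x))) =
        √2 * (cos (θ / 2) * cos x) := by
      rw [cos_two_mul, cos_arccos (hbd x).1.le (hbd x).2.le]
      have h1 : cos θ = 2 * cos (θ / 2) ^ 2 - 1 := by rw [← cos_two_mul]; ring_nf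
      rw [h1, ← sqrt_sq (by positivity : 0 ≤ cos (θ / 2) * cos x), ← sqrt_mul (by norm_num)]
      congr 1
      linear_combination (-2 * cos (θ / 2) ^ 2) * sin_sq_add_cos_sq x
    have h2 : (√2) ^ 2 = (2 : ℝ) := sq_sqrt (by norm_num)
    rw [hroot, mul_div_cancel_left₀ _ (by norm_num : (2 : ℝ) ≠ 0), sin_arccos, smul_eq_mul,
      ← mul_pow, ← hss, sqrt_sq hsq.le, abs_mul, abs_mul, abs_neg, abs_of_pos (one_div_pos.2 hsq),
      abs_of_pos (mul_pos hC hc), abs_two]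
    have h3 : (0 : ℝ) < √2 := by positivity
    field_simp
    rw [h2]
    ring
  · intro x _
    exact ((((hasDerivAt_arccos (hbd x).1.ne' (hbd x).2.ne).comp x
      ((hasDerivAt_sin x).const_mul _))).const_mul 2).hasDerivWithinAt
  · intro x hx y hy hxy
    have h1 : arccos (cos (θ / 2) * sin x) = arccos (cos (θ / 2) * sin y) := by
      simpa using hxy
    have h2 := arccos_injOn ⟨(hbd x).1.le, (hbd x).2.le⟩ ⟨(hbd y).1.le, (hbd y).2.le⟩ h1
    exact injOn_sin ⟨hx.1.le, hx.2.le⟩ ⟨hy.1.le, hy.2.le⟩ (mul_left_cancel₀ hC.ne' h2)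

theorem one_sub_two_mul_mul_cos_add_sq_pos {z : ℝ} (hz : |z| < 1) (t : ℝ) :
    0 < 1 - 2 * z * cos t + z ^ 2 := by
  have h1 : z * cos t ≤ |z| := by
    refine (le_abs_self _).trans ?_
    rw [abs_mul]
    exact mul_le_of_le_one_right (abs_nonneg z) (abs_cos_le_one t)
  nlinarith [sq_abs z]

theorem hasSum_one_sub_cos_mul_pow {z : ℝ} (hz : |z| < 1) (t : ℝ) :
    HasSum (fun m : ℕ => (1 - cos ((m + 1 : ℝ) * t)) * z ^ m)
      ((1 + z) * (1 - cos t) / ((1 - z) * (1 - 2 * z * cos t + z ^ 2))) := by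
  have hD := one_sub_two_mul_mul_cos_add_sq_pos hz t
  have hz1 : 1 - z ≠ 0 := by linarith [(abs_lt.1 hz).2]
  have hnorm : ‖(z : ℂ) * Complex.exp (t * Complex.I)‖ < 1 := by
    rw [norm_mul, Complex.norm_exp_ofReal_mul_I, mul_one, Complex.norm_real]
    exact hz
  have h := Complex.hasSum_re ((hasSum_geometric_of_norm_lt_one hnorm).mul_left
    (Complex.exp (t * Complex.I)))
  have hterm : ∀ m : ℕ, (Complex.exp (t * Complex.I) *
      ((z : ℂ) * Complex.exp (t * Complex.I)) ^ m).re = cos ((m + 1 : ℝ) * t) * z ^ m := by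
    intro m
    have : Complex.exp (t * Complex.I) * ((z : ℂ) * Complex.exp (t * Complex.I)) ^ m =
        ((z ^ m : ℝ) : ℂ) * Complex.exp (((m + 1 : ℝ) * t : ℝ) * Complex.I) := by
      rw [mul_pow, ← Complex.exp_nat_mul, mul_left_comm, ← Complex.exp_add]
      push_cast
      ring_nf
    rw [this, Complex.re_ofReal_mul, Complex.exp_ofReal_mul_I_re, mul_comm]
  have hval : (Complex.exp (t * Complex.I) *
      (1 - (z : ℂ) * Complex.exp (t * Complex.I))⁻¹).re =
      (cos t - z) / (1 - 2 * z * cos t + z ^ 2) := by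
    have hsq : Complex.normSq (1 - (z : ℂ) * Complex.exp (t * Complex.I)) =
        1 - 2 * z * cos t + z ^ 2 := by
      rw [Complex.normSq_apply]
      simp only [Complex.sub_re, Complex.one_re, Complex.re_ofReal_mul, Complex.sub_im,
        Complex.one_im, Complex.im_ofReal_mul, Complex.exp_ofReal_mul_I_re,
        Complex.exp_ofReal_mul_I_im]
      linear_combination z ^ 2 * sin_sq_add_cos_sq t
    rw [Complex.mul_re, Complex.inv_re, Complex.inv_im, hsq]
    simp only [Complex.sub_re, Complex.one_re, Complex.re_ofReal_mul, Complex.sub_im,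
      Complex.one_im, Complex.im_ofReal_mul, Complex.exp_ofReal_mul_I_re,
      Complex.exp_ofReal_mul_I_im]
    generalize 1 - 2 * z * cos t + z ^ 2 = D at hD
    have hD' := hD.ne'
    field_simp
    linear_combination (-z) * sin_sq_add_cos_sq t
  simp only [hterm, hval] at h
  have h2 := (hasSum_geometric_of_abs_lt_one hz).sub h
  have e : (1 - z)⁻¹ - (cos t - z) / (1 - 2 * z * cos t + z ^ 2) =
      (1 + z) * (1 - cos t) / ((1 - z) * (1 - 2 * z * cos t + z ^ 2)) := by
    rw [inv_eq_one_div, div_sub_div _ _ hz1 hD.ne']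
    ring
  rw [e] at h2
  refine h2.congr_fun fun m => ?_
  ring

theorem hasSum_integral_one_sub_cos_mul_pow {θ : ℝ} (hθ : 0 < θ) (hθ' : θ < π) {z : ℝ}
    (hz : |z| < 1) :
    HasSum (fun m : ℕ => (∫ x in (-(π / 2))..(π / 2),
        (1 - cos ((m + 1 : ℝ) * (2 * arccos (cos (θ / 2) * sin x)))) /
          (1 - cos (θ / 2) ^ 2 * sin x ^ 2)) * z ^ m)
      (2 * π / (√(1 - 2 * z * cos θ + z ^ 2) * (1 - z))) := by
  have hC : 0 < cos (θ / 2) := cos_pos_of_mem_Ioo ⟨by linarith, by linarith⟩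
  have hC1 : cos (θ / 2) < 1 := by
    have := cos_lt_cos_of_nonneg_of_le_pi le_rfl (by linarith) (by linarith : 0 < θ / 2)
    simpa using this
  have hz' := abs_lt.1 hz
  have hS : 0 < 1 - cos (θ / 2) ^ 2 := by nlinarith
  have hle : ∀ x, 1 - cos (θ / 2) ^ 2 ≤ 1 - cos (θ / 2) ^ 2 * sin x ^ 2 := fun x => by
    nlinarith [sin_sq_le_one x, sq_nonneg (cos (θ / 2))]
  have hD := one_sub_two_mul_mul_cos_add_sq_pos hz θ
  have hsum := intervalIntegral.hasSum_integral_of_dominated_convergence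
    (μ := MeasureTheory.volume) (a := -(π / 2)) (b := π / 2)
    (F := fun (m : ℕ) x => (1 - cos ((m + 1 : ℝ) * (2 * arccos (cos (θ / 2) * sin x)))) /
          (1 - cos (θ / 2) ^ 2 * sin x ^ 2) * z ^ m)
    (f := fun x => 2 * (1 + z) / (1 - z) * (1 / ((1 + z) ^ 2 * cos x ^ 2 +
      √(1 - 2 * z * cos θ + z ^ 2) ^ 2 * sin x ^ 2)))
    (fun m _ => 2 / (1 - cos (θ / 2) ^ 2) * |z| ^ m) ?_ ?_ ?_ ?_ ?_
  · simp only [intervalIntegral.integral_mul_const, intervalIntegral.integral_const_mul] at hsum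
    rw [integral_inv_sq_mul_cos_sq_add_sq_mul_sin_sq (by linarith) (sqrt_pos.2 hD)] at hsum
    have h1 : 1 + z ≠ 0 := by linarith
    have h2 : 1 - z ≠ 0 := by linarith
    have h3 := (sqrt_pos.2 hD).ne'
    have e : 2 * (1 + z) / (1 - z) * (π / ((1 + z) * √(1 - 2 * z * cos θ + z ^ 2))) =
        2 * π / (√(1 - 2 * z * cos θ + z ^ 2) * (1 - z)) := by
      generalize √(1 - 2 * z * cos θ + z ^ 2) = w at h3
      field_simp
    rwa [e] at hsum
  · intro m
    apply Continuous.aestronglyMeasurable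
    refine Continuous.mul (Continuous.div (by fun_prop) (by fun_prop) fun x => ?_) (by fun_prop)
    exact (hS.trans_le (hle x)).ne'
  · refine fun m => Filter.Eventually.of_forall fun x _ => ?_
    rw [norm_mul, norm_div, norm_pow, norm_eq_abs, norm_eq_abs, norm_eq_abs,
      abs_of_pos (hS.trans_le (hle x))]
    gcongr ?_ / ?_ * _
    · rw [abs_le]
      constructor <;> linarith [cos_le_one ((m + 1 : ℝ) * (2 * arccos (cos (θ / 2) * sin x))),
        neg_one_le_cos ((m + 1 : ℝ) * (2 * arccos (cos (θ / 2) * sin x)))]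
    · exact hle x
  · refine Filter.Eventually.of_forall fun x _ => ?_
    exact (summable_geometric_of_lt_one (abs_nonneg z) hz).mul_left _
  · exact intervalIntegrable_const
  · refine Filter.Eventually.of_forall fun x _ => ?_
    have h := (hasSum_one_sub_cos_mul_pow hz (2 * arccos (cos (θ / 2) * sin x))).div_const
      (1 - cos (θ / 2) ^ 2 * sin x ^ 2)
    have hDx := one_sub_two_mul_mul_cos_add_sq_pos hz (2 * arccos (cos (θ / 2) * sin x))
    have hx := hS.trans_le (hle x)
    have h1 : cos θ = 2 * cos (θ / 2) ^ 2 - 1 := by rw [← cos_two_mul]; ring_nf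
    have h2 : cos (2 * arccos (cos (θ / 2) * sin x)) = 2 * (cos (θ / 2) * sin x) ^ 2 - 1 := by
      rw [cos_two_mul, cos_arccos] <;> nlinarith [sin_le_one x, neg_one_le_sin x]
    have h3 : (1 + z) ^ 2 * cos x ^ 2 + √(1 - 2 * z * cos θ + z ^ 2) ^ 2 * sin x ^ 2 =
        1 - 2 * z * cos (2 * arccos (cos (θ / 2) * sin x)) + z ^ 2 := by
      rw [sq_sqrt hD.le, h1, h2]
      linear_combination (1 + z) ^ 2 * sin_sq_add_cos_sq x
    have h4 : 1 - cos (2 * arccos (cos (θ / 2) * sin x)) =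
        2 * (1 - cos (θ / 2) ^ 2 * sin x ^ 2) := by
      rw [h2]; ring
    have h5 : 1 - z ≠ 0 := by linarith
    have e : (1 + z) * (1 - cos (2 * arccos (cos (θ / 2) * sin x))) /
        ((1 - z) * (1 - 2 * z * cos (2 * arccos (cos (θ / 2) * sin x)) + z ^ 2)) /
        (1 - cos (θ / 2) ^ 2 * sin x ^ 2) = 2 * (1 + z) / (1 - z) *
        (1 / (1 - 2 * z * cos (2 * arccos (cos (θ / 2) * sin x)) + z ^ 2)) := by
      rw [h4]
      have hDx' := hDx.ne'
      have hx' := hx.ne'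
      generalize 1 - 2 * z * cos (2 * arccos (cos (θ / 2) * sin x)) + z ^ 2 = D at hDx'
      generalize 1 - cos (θ / 2) ^ 2 * sin x ^ 2 = S at hx'
      field_simp
    rw [e] at h
    rw [h3]
    refine h.congr_fun fun m => ?_
    ring

theorem eq_of_hasSum_mul_pow {a b : ℕ → ℝ} {f : ℝ → ℝ} {r : ℝ} (hr : 0 < r)
    (ha : ∀ z, |z| < r → HasSum (fun m => a m * z ^ m) (f z))
    (hb : ∀ z, |z| < r → HasSum (fun m => b m * z ^ m) (f z)) : a = b := by
  have key : ∀ c : ℕ → ℝ, (∀ z, |z| < r → HasSum (fun m => c m * z ^ m) (f z)) →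
      HasFPowerSeriesAt f (FormalMultilinearSeries.ofScalars ℝ c) 0 := by
    intro c hc
    rw [hasFPowerSeriesAt_iff]
    filter_upwards [Metric.ball_mem_nhds (0 : ℝ) hr] with z hz
    have := hc z (by simpa using hz)
    simpa [FormalMultilinearSeries.coeff_ofScalars, mul_comm] using this
  have h := (key a ha).eq_formalMultilinearSeries (key b hb)
  ext m
  have := congrArg (fun p => FormalMultilinearSeries.coeff p m) h
  simpa [FormalMultilinearSeries.coeff_ofScalars] using this

/-- If Σ aₘ zᵐ = 1/(√(1−2z·cos θ+z²)·(1−z)) for all |z| < ε, then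
aₙ = 1/(2 sin(θ/2)) − (1/(2√2·π))·∫_θ^{2π−θ} cos((n+1)t)/(√(cos θ − cos t)·sin(t/2)) dt. -/
theorem R_n_integral_representation (θ : ℝ) (hθ : 0 < θ) (hθ' : θ < Real.pi)
    (n : ℕ) (a : ℕ → ℝ) (ε : ℝ) (hε : 0 < ε)
    (ha : ∀ z : ℝ, |z| < ε →
      HasSum (fun m : ℕ => a m * z ^ m)
        (1 / (Real.sqrt (1 - 2 * z * Real.cos θ + z ^ 2) * (1 - z)))) :
    a n = 1 / (2 * Real.sin (θ / 2)) -
      1 / (2 * Real.sqrt 2 * Real.pi) *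
        ∫ t in θ..(2 * Real.pi - θ),
          Real.cos ((n + 1 : ℝ) * t) /
            (Real.sqrt (Real.cos θ - Real.cos t) * Real.sin (t / 2)) := by
  have hs : 0 < sin (θ / 2) := sin_pos_of_pos_of_lt_pi (by linarith) (by linarith)
  have hcs : 1 - cos (θ / 2) ^ 2 = sin (θ / 2) ^ 2 := by
    linarith [sin_sq_add_cos_sq (θ / 2)]
  have hpos : ∀ x, 1 - cos (θ / 2) ^ 2 * sin x ^ 2 ≠ 0 := fun x => by
    have : 0 < sin (θ / 2) ^ 2 := by positivity
    nlinarith [sin_sq_le_one x, sq_nonneg (cos (θ / 2))]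
  have hab := eq_of_hasSum_mul_pow (lt_min hε one_pos)
    (fun z hz => ha z (hz.trans_le (min_le_left _ _)))
    (b := fun m : ℕ => 1 / (2 * π) * ∫ x in (-(π / 2))..(π / 2),
        (1 - cos ((m + 1 : ℝ) * (2 * arccos (cos (θ / 2) * sin x)))) /
          (1 - cos (θ / 2) ^ 2 * sin x ^ 2))
    (fun z hz => by
      have h := (hasSum_integral_one_sub_cos_mul_pow hθ hθ'
        (hz.trans_le (min_le_right _ _))).mul_left (1 / (2 * π))
      have e : 1 / (2 * π) * (2 * π / (√(1 - 2 * z * cos θ + z ^ 2) * (1 - z))) =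
          1 / (√(1 - 2 * z * cos θ + z ^ 2) * (1 - z)) := by
        rw [← mul_div_assoc, one_div_mul_cancel (by positivity)]
      rw [e] at h
      refine h.congr_fun fun m => ?_
      ring)
  have hone : ∫ x in (-(π / 2))..(π / 2), 1 / (1 - cos (θ / 2) ^ 2 * sin x ^ 2) =
      π / sin (θ / 2) := by
    have h := integral_inv_sq_mul_cos_sq_add_sq_mul_sin_sq one_pos hs
    rw [one_mul] at h
    rw [← h]
    congr 1
    ext x
    rw [← hcs]
    congr 1
    linear_combination -sin_sq_add_cos_sq x
  rw [hab, integral_div_sqrt_cos_sub_cos_mul_sin_half hθ hθ' fun t => cos ((n + 1 : ℝ) * t)]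
  simp only [sub_div]
  rw [intervalIntegral.integral_sub, hone]
  · field_simp
  · exact (continuous_const.div (by fun_prop) hpos).intervalIntegrable _ _
  · exact (Continuous.div (by fun_prop) (by fun_prop) hpos).intervalIntegrable _ _
end

section
/- Let θ ∈ ℝ with 0 < θ < π. Then (1/(2√2·π))·∫_θ^{2π−θ} 1/(√(cos θ − cos t)·sin(t/2)) dt = 1/(2 sin(θ/2)). -/
open Real intervalIntegral

theorem cos_sub_cos_pos_of_mem_Ioo {θ t : ℝ} (hθ : 0 < θ) (ht : t ∈ Set.Ioo θ (2 * π - θ)) :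
    0 < cos θ - cos t := by
  obtain ⟨h1, h2⟩ := ht
  have ha : 0 < sin ((t + θ) / 2) := sin_pos_of_pos_of_lt_pi (by linarith) (by linarith)
  have hb : 0 < sin ((t - θ) / 2) := sin_pos_of_pos_of_lt_pi (by linarith) (by linarith)
  have h := cos_sub_cos t θ
  nlinarith [mul_pos ha hb]

/-- An antiderivative of `t ↦ 1 / (√(cos θ - cos t) * sin (t / 2))` on `(θ, 2π - θ)`. -/
theorem hasDerivAt_arcsin_tan_mul_cot {θ t : ℝ} (hθ : 0 < θ) (hθ' : θ < π)
    (ht : t ∈ Set.Ioo θ (2 * π - θ)) :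
    HasDerivAt
      (fun x => -(√2 / sin (θ / 2)) *
        arcsin (sin (θ / 2) / cos (θ / 2) * (cos (x / 2) / sin (x / 2))))
      (1 / (√(cos θ - cos t) * sin (t / 2))) t := by
  have hs : 0 < sin (θ / 2) := sin_pos_of_pos_of_lt_pi (by linarith) (by linarith)
  have hc : 0 < cos (θ / 2) := cos_pos_of_mem_Ioo ⟨by linarith, by linarith⟩
  have hS : 0 < sin (t / 2) :=
    sin_pos_of_pos_of_lt_pi (by linarith [ht.1]) (by linarith [ht.2])
  have hpos := cos_sub_cos_pos_of_mem_Ioo hθ ht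
  have hθ2 : cos θ = 2 * cos (θ / 2) ^ 2 - 1 := by rw [← cos_two_mul]; congr 1; ring
  have ht2 : cos t = 2 * cos (t / 2) ^ 2 - 1 := by rw [← cos_two_mul]; congr 1; ring
  have hu : HasDerivAt (fun x : ℝ => sin (θ / 2) / cos (θ / 2) * (cos (x / 2) / sin (x / 2)))
      (sin (θ / 2) / cos (θ / 2) * (-(1 / 2) / sin (t / 2) ^ 2)) t := by
    have hid : HasDerivAt (fun x : ℝ => x / 2) (1 / 2) t := (hasDerivAt_id t).div_const 2
    refine ((hid.cos.div hid.sin hS.ne').const_mul (sin (θ / 2) / cos (θ / 2))).congr_deriv ?_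
    congr 2
    linear_combination -(1 / 2) * sin_sq_add_cos_sq (t / 2)
  set u := sin (θ / 2) / cos (θ / 2) * (cos (t / 2) / sin (t / 2)) with hu_def
  have hkey : cos θ - cos t = (√2 * cos (θ / 2) * sin (t / 2)) ^ 2 * (1 - u ^ 2) := by
    have h2 : √2 ^ 2 = 2 := sq_sqrt (by norm_num)
    rw [mul_pow, mul_pow, h2, hu_def, hθ2, ht2]
    field_simp
    linear_combination (-2 * cos (θ / 2) ^ 2) * sin_sq_add_cos_sq (t / 2) +
      2 * cos (t / 2) ^ 2 * sin_sq_add_cos_sq (θ / 2)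
  have hu1 : 0 < 1 - u ^ 2 := by
    rw [hkey] at hpos
    exact pos_of_mul_pos_right hpos (sq_nonneg _)
  have hroot : √(cos θ - cos t) = √2 * cos (θ / 2) * sin (t / 2) * √(1 - u ^ 2) := by
    rw [hkey, sqrt_mul (sq_nonneg _), sqrt_sq (by positivity)]
  have hR : 0 < √(1 - u ^ 2) := sqrt_pos.2 hu1
  have harcsin := hasDerivAt_arcsin (x := u) (by rintro h; norm_num [h] at hu1)
    (by rintro h; norm_num [h] at hu1)
  refine ((harcsin.comp t hu).const_mul (-(√2 / sin (θ / 2)))).congr_deriv ?_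
  rw [hroot]
  have h2 : √2 ^ 2 = 2 := sq_sqrt (by norm_num)
  field_simp
  linarith

/-- For 0 < θ < π, (1/(2√2·π))·∫_θ^{2π−θ} 1/(√(cos θ − cos t)·sin(t/2)) dt = 1/(2 sin(θ/2)). -/
theorem integral_identity (θ : ℝ) (hθ : 0 < θ) (hθ' : θ < Real.pi) :
    1 / (2 * Real.sqrt 2 * Real.pi) *
      ∫ t in θ..(2 * Real.pi - θ),
        1 / (Real.sqrt (Real.cos θ - Real.cos t) * Real.sin (t / 2)) =
    1 / (2 * Real.sin (θ / 2)) := by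
  have hle : θ ≤ 2 * π - θ := by linarith
  have hs : 0 < sin (θ / 2) := sin_pos_of_pos_of_lt_pi (by linarith) (by linarith)
  have hc : 0 < cos (θ / 2) := cos_pos_of_mem_Ioo ⟨by linarith, by linarith⟩
  have hS : ∀ t ∈ Set.Icc θ (2 * π - θ), 0 < sin (t / 2) := fun t ht =>
    sin_pos_of_pos_of_lt_pi (by linarith [ht.1]) (by linarith [ht.2])
  have hcont : ContinuousOn
      (fun x => -(√2 / sin (θ / 2)) *
        arcsin (sin (θ / 2) / cos (θ / 2) * (cos (x / 2) / sin (x / 2))))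
      (Set.Icc θ (2 * π - θ)) := by
    refine continuousOn_const.mul (continuous_arcsin.comp_continuousOn
      (continuousOn_const.mul (ContinuousOn.div ?_ ?_ fun t ht => (hS t ht).ne')))
    · fun_prop
    · fun_prop
  have hderiv := fun t (ht : t ∈ Set.Ioo θ (2 * π - θ)) =>
    hasDerivAt_arcsin_tan_mul_cot hθ hθ' ht
  have hint := integrableOn_deriv_of_nonneg hcont hderiv fun t ht => by
    have := hS t (Set.Ioo_subset_Icc_self ht)
    positivity
  rw [integral_eq_sub_of_hasDerivAt_of_le hle hcont hderiv
    ((intervalIntegrable_iff_integrableOn_Ioc_of_le hle).2 hint)]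
  have hhalf : (2 * π - θ) / 2 = π - θ / 2 := by ring
  have hleft : sin (θ / 2) / cos (θ / 2) * (cos (θ / 2) / sin (θ / 2)) = 1 := by field_simp
  have hright : sin (θ / 2) / cos (θ / 2) * (-cos (θ / 2) / sin (θ / 2)) = -1 := by field_simp
  rw [hhalf, cos_pi_sub, sin_pi_sub, hleft, hright, arcsin_neg, arcsin_one]
  field_simp
  ring
end

section
/- Let θ ∈ ℝ with 0 < θ ≤ π, let n be a natural number, and suppose (aₘ) is a sequence of real numbers and ε > 0 is such that for all real z with |z| < ε one has Σ_{m} aₘ zᵐ = 1/(√(1−2z·cos θ+z²)·(1−z)) (√ denoting the positive real square root; note 1−2z·cos θ+z² > 0 for |z| < 1). Then aₙ ≤ 1/sin(θ/2). -/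
open Real

open MeasureTheory Filter Topology

/-- Two real power series with the same sum near `0` have the same coefficients. -/
theorem coeff_eq_of_eventually_hasSum {a b : ℕ → ℝ} {g : ℝ → ℝ}
    (ha : ∀ᶠ z in 𝓝 (0 : ℝ), HasSum (fun m : ℕ => a m * z ^ m) (g z))
    (hb : ∀ᶠ z in 𝓝 (0 : ℝ), HasSum (fun m : ℕ => b m * z ^ m) (g z)) : a = b := by
  have key : ∀ c : ℕ → ℝ,
      (∀ᶠ z in 𝓝 (0 : ℝ), HasSum (fun m : ℕ => c m * z ^ m) (g z)) →
        HasFPowerSeriesAt g (FormalMultilinearSeries.ofScalars ℝ c) 0 := by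
    intro c hc
    rw [hasFPowerSeriesAt_iff]
    filter_upwards [hc] with z hz
    simpa [FormalMultilinearSeries.coeff_ofScalars, mul_comm] using hz
  have h := (key a ha).eq_formalMultilinearSeries (key b hb)
  funext n
  simpa [FormalMultilinearSeries.coeff_ofScalars] using
    congrArg (fun p : FormalMultilinearSeries ℝ ℝ ℝ => p.coeff n) h

theorem integrable_inv_sq_add_sq_mul_sq {p q : ℝ} (hp : 0 < p) (hq : 0 < q) :
    Integrable fun x : ℝ => (p ^ 2 + q ^ 2 * x ^ 2)⁻¹ := by
  have h := (integrable_inv_one_add_sq.comp_mul_left' (R := q / p) (by positivity)).const_mul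
    (p ^ 2)⁻¹
  refine h.congr (Eventually.of_forall fun x => ?_)
  simp only
  rw [← mul_inv]
  congr 1
  field_simp

theorem integral_inv_sq_add_sq_mul_sq {p q : ℝ} (hp : 0 < p) (hq : 0 < q) :
    ∫ x : ℝ, (p ^ 2 + q ^ 2 * x ^ 2)⁻¹ = π / (p * q) := by
  have h : ∀ x : ℝ, (p ^ 2 + q ^ 2 * x ^ 2)⁻¹ = (p ^ 2)⁻¹ * (1 + (q / p * x) ^ 2)⁻¹ := by
    intro x
    rw [← mul_inv]
    congr 1
    field_simp
  simp_rw [h]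
  rw [integral_const_mul, Measure.integral_comp_mul_left (fun x : ℝ => (1 + x ^ 2)⁻¹) (q / p),
    integral_univ_inv_one_add_sq, abs_of_pos (by positivity), smul_eq_mul]
  field_simp

theorem one_sub_two_mul_mul_add_sq_pos {z c : ℝ} (hz : |z| < 1) (hc : |c| ≤ 1) :
    0 < 1 - 2 * z * c + z ^ 2 := by
  have h : z * c ≤ |z| := calc
    z * c ≤ |z * c| := le_abs_self _
    _ = |z| * |c| := abs_mul _ _
    _ ≤ |z| := mul_le_of_le_one_right (abs_nonneg _) hc
  nlinarith [sq_abs z, pow_pos (sub_pos.2 hz) 2]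

/-- The Poisson-type generating function of `cos ((n + 1) φ)`. -/
theorem hasSum_cos_succ_mul_pow {z : ℝ} (hz : |z| < 1) (φ : ℝ) :
    HasSum (fun n : ℕ => cos ((n + 1) * φ) * z ^ n)
      ((cos φ - z) / (1 - 2 * z * cos φ + z ^ 2)) := by
  set w : ℂ := Complex.exp (φ * Complex.I) with hw
  have hnorm : ‖(z : ℂ) * w‖ < 1 := by
    rw [norm_mul, hw, Complex.norm_exp_ofReal_mul_I, mul_one, Complex.norm_real]
    exact hz
  have h := Complex.hasSum_re ((hasSum_geometric_of_norm_lt_one hnorm).mul_left w)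
  have hre : w.re = cos φ := Complex.exp_ofReal_mul_I_re φ
  have him : w.im = sin φ := Complex.exp_ofReal_mul_I_im φ
  convert h using 1
  · funext n
    have : w * (z * w) ^ n = ((z ^ n : ℝ) : ℂ) * Complex.exp (((n + 1) * φ : ℝ) * Complex.I) := by
      rw [mul_pow, hw, ← Complex.exp_nat_mul]
      push_cast
      rw [show ((n : ℂ) + 1) * φ * Complex.I = φ * Complex.I + n * (φ * Complex.I) by ring,
        Complex.exp_add]
      ring
    rw [this, Complex.re_ofReal_mul, Complex.exp_ofReal_mul_I_re, mul_comm]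
  · have hns : Complex.normSq (1 - z * w) = 1 - 2 * z * cos φ + z ^ 2 := by
      rw [Complex.normSq_apply]
      simp [hre, him]
      linear_combination z ^ 2 * sin_sq_add_cos_sq φ
    rw [← div_eq_mul_inv, Complex.div_re, hns]
    simp only [Complex.sub_re, Complex.sub_im, Complex.one_re, Complex.one_im,
      Complex.re_ofReal_mul, Complex.im_ofReal_mul, hre, him]
    rw [← add_div]
    congr 1
    linear_combination z * sin_sq_add_cos_sq φ

/-- The generating function of the (rescaled) Fejér kernels. -/
theorem hasSum_one_sub_cos_succ_mul_pow {z : ℝ} (hz : |z| < 1) (φ : ℝ) :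
    HasSum (fun n : ℕ => (1 - cos ((n + 1) * φ)) * z ^ n)
      ((1 + z) * (1 - cos φ) / ((1 - z) * (1 - 2 * z * cos φ + z ^ 2))) := by
  have h1 : 1 - z ≠ 0 := (sub_pos.2 (abs_lt.1 hz).2).ne'
  have h2 := (one_sub_two_mul_mul_add_sq_pos hz (abs_cos_le_one φ)).ne'
  convert (hasSum_geometric_of_abs_lt_one hz).sub (hasSum_cos_succ_mul_pow hz φ) using 1
  · rfl
  · funext n
    ring
  · rw [← one_div, div_sub_div _ _ h1 h2]
    congr 1
    ring

/-- The integrand in the integral representation of `R_n (1 - 2 s ^ 2)`, where `s = sin (θ / 2)`: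
a Fejér kernel evaluated at the angle with cosine `(1 - 2 s ^ 2 - x ^ 2) / (1 + x ^ 2)`. -/
noncomputable def fejerIntegrand (s : ℝ) (n : ℕ) (x : ℝ) : ℝ :=
  (1 - cos ((n + 1) * arccos ((1 - 2 * s ^ 2 - x ^ 2) / (1 + x ^ 2)))) * (2 * (s ^ 2 + x ^ 2))⁻¹

theorem fejerIntegrand_nonneg (s : ℝ) (n : ℕ) (x : ℝ) : 0 ≤ fejerIntegrand s n x :=
  mul_nonneg (sub_nonneg.2 (cos_le_one _)) (by positivity)

theorem fejerIntegrand_le (s : ℝ) (n : ℕ) (x : ℝ) :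
    fejerIntegrand s n x ≤ (s ^ 2 + 1 ^ 2 * x ^ 2)⁻¹ := by
  let φ : ℝ := (n + 1) * arccos ((1 - 2 * s ^ 2 - x ^ 2) / (1 + x ^ 2))
  calc fejerIntegrand s n x ≤ 2 * (2 * (s ^ 2 + x ^ 2))⁻¹ :=
        mul_le_mul_of_nonneg_right (by linarith [neg_one_le_cos φ]) (by positivity)
    _ = (s ^ 2 + 1 ^ 2 * x ^ 2)⁻¹ := by rw [mul_inv]; ring

theorem integrable_fejerIntegrand {s : ℝ} (hs : 0 < s) (n : ℕ) :
    Integrable (fejerIntegrand s n) := by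
  refine (integrable_inv_sq_add_sq_mul_sq hs one_pos).mono' ?_ (Eventually.of_forall fun x => ?_)
  · refine Measurable.aestronglyMeasurable ?_
    unfold fejerIntegrand
    fun_prop
  · rw [norm_of_nonneg (fejerIntegrand_nonneg s n x)]
    exact fejerIntegrand_le s n x

theorem integral_fejerIntegrand_le {s : ℝ} (hs : 0 < s) (n : ℕ) :
    ∫ x, fejerIntegrand s n x ≤ π / s := by
  calc ∫ x, fejerIntegrand s n x ≤ ∫ x : ℝ, (s ^ 2 + 1 ^ 2 * x ^ 2)⁻¹ :=
        integral_mono (integrable_fejerIntegrand hs n)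
          (integrable_inv_sq_add_sq_mul_sq hs one_pos) (fejerIntegrand_le s n)
    _ = π / s := by rw [integral_inv_sq_add_sq_mul_sq hs one_pos, mul_one]

theorem hasSum_fejerIntegrand_mul_pow {s z : ℝ} (hs : 0 < s) (hs1 : s ≤ 1) (hz : |z| < 1)
    (x : ℝ) :
    HasSum (fun n : ℕ => fejerIntegrand s n x * z ^ n)
      ((1 + z) / (1 - z) * (1 - 2 * z * (1 - 2 * s ^ 2) + z ^ 2 + (1 + z) ^ 2 * x ^ 2)⁻¹) := by
  set c := (1 - 2 * s ^ 2 - x ^ 2) / (1 + x ^ 2) with hc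
  have hx : 0 < 1 + x ^ 2 := by positivity
  have hc1 : -1 ≤ c := by
    rw [hc, le_div_iff₀ hx]
    nlinarith
  have hc2 : c ≤ 1 := by
    rw [hc, div_le_iff₀ hx]
    nlinarith [sq_nonneg x, sq_nonneg s]
  have h := (hasSum_one_sub_cos_succ_mul_pow hz (arccos c)).mul_right (2 * (s ^ 2 + x ^ 2))⁻¹
  rw [cos_arccos hc1 hc2] at h
  have h1 : 0 < 1 - z := by linarith [(abs_lt.1 hz).2]
  have h2 := one_sub_two_mul_mul_add_sq_pos hz (abs_le.2 ⟨hc1, hc2⟩)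
  have h3 : 1 - 2 * z * (1 - 2 * s ^ 2) + z ^ 2 + (1 + z) ^ 2 * x ^ 2
      = (1 + x ^ 2) * (1 - 2 * z * c + z ^ 2) := by
    rw [hc]
    field_simp
    ring
  have h4 : 1 - c = 2 * (s ^ 2 + x ^ 2) / (1 + x ^ 2) := by
    rw [hc]
    field_simp
    ring
  convert h using 1
  · rfl
  · funext n
    rw [fejerIntegrand, ← hc]
    ring
  · have h5 : 0 < s ^ 2 + x ^ 2 := by positivity
    rw [h3, h4]
    field_simp

theorem hasSum_integral_fejerIntegrand_mul_pow {s z : ℝ} (hs : 0 < s) (hs1 : s ≤ 1)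
    (hz : |z| < 1) :
    HasSum (fun n : ℕ => (π⁻¹ * ∫ x, fejerIntegrand s n x) * z ^ n)
      (1 / (√(1 - 2 * z * (1 - 2 * s ^ 2) + z ^ 2) * (1 - z))) := by
  have hint : ∀ n : ℕ, Integrable fun x => fejerIntegrand s n x * z ^ n := fun n =>
    (integrable_fejerIntegrand hs n).mul_const _
  have hsum : Summable fun n : ℕ => ∫ x, ‖fejerIntegrand s n x * z ^ n‖ := by
    refine Summable.of_nonneg_of_le (fun n => integral_nonneg fun x => norm_nonneg _) (fun n => ?_)
      ((summable_geometric_of_lt_one (abs_nonneg z) hz).mul_left (π / s))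
    simp_rw [norm_mul, norm_of_nonneg (fejerIntegrand_nonneg s n _), norm_pow, Real.norm_eq_abs]
    rw [integral_mul_const]
    exact mul_le_mul_of_nonneg_right (integral_fejerIntegrand_le hs n) (by positivity)
  have h := (hasSum_integral_of_summable_integral_norm hint hsum).mul_left π⁻¹
  have hD : 0 < 1 - 2 * z * (1 - 2 * s ^ 2) + z ^ 2 :=
    one_sub_two_mul_mul_add_sq_pos hz (abs_le.2 ⟨by nlinarith, by nlinarith⟩)
  have h1 : 0 < 1 - z := by linarith [(abs_lt.1 hz).2]
  have h2 : 0 < 1 + z := by linarith [(abs_lt.1 hz).1]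
  have hI := integral_inv_sq_add_sq_mul_sq (sqrt_pos.2 hD) h2
  rw [sq_sqrt hD.le] at hI
  simp_rw [(hasSum_fejerIntegrand_mul_pow hs hs1 hz _).tsum_eq] at h
  rw [integral_const_mul, hI] at h
  convert h using 1
  · rfl
  · funext n
    rw [integral_mul_const, mul_assoc]
  · have := sqrt_pos.2 hD
    field_simp

/-- If Σ aₘ zᵐ = 1/(√(1−2z·cos θ+z²)·(1−z)) for all |z| < ε, then aₙ ≤ 1/sin(θ/2). -/
theorem R_n_bound (θ : ℝ) (hθ : 0 < θ) (hθ' : θ ≤ Real.pi)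
    (n : ℕ) (a : ℕ → ℝ) (ε : ℝ) (hε : 0 < ε)
    (ha : ∀ z : ℝ, |z| < ε →
      HasSum (fun m : ℕ => a m * z ^ m)
        (1 / (Real.sqrt (1 - 2 * z * Real.cos θ + z ^ 2) * (1 - z)))) :
    a n ≤ 1 / Real.sin (θ / 2) := by
  have hs : 0 < sin (θ / 2) := sin_pos_of_pos_of_lt_pi (by linarith) (by linarith)
  have hcos : 1 - 2 * sin (θ / 2) ^ 2 = cos θ := by
    rw [sin_sq_eq_half_sub, mul_div_cancel₀ θ two_ne_zero]
    ring
  have hball : ∀ r : ℝ, 0 < r → ∀ᶠ z in 𝓝 (0 : ℝ), |z| < r := fun r hr => by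
    filter_upwards [Metric.ball_mem_nhds (0 : ℝ) hr] with z hz
    simpa using hz
  have hab : a = fun n => π⁻¹ * ∫ x, fejerIntegrand (sin (θ / 2)) n x := by
    refine coeff_eq_of_eventually_hasSum ((hball ε hε).mono ha)
      ((hball 1 one_pos).mono fun z hz => ?_)
    rw [← hcos]
    exact hasSum_integral_fejerIntegrand_mul_pow hs (sin_le_one _) hz
  calc a n = π⁻¹ * ∫ x, fejerIntegrand (sin (θ / 2)) n x := congrFun hab n
    _ ≤ π⁻¹ * (π / sin (θ / 2)) :=
      mul_le_mul_of_nonneg_left (integral_fejerIntegrand_le hs n) (by positivity)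
    _ = 1 / sin (θ / 2) := by
      field_simp
end

section
/- Let θ ∈ ℝ with 0 < θ ≤ π, let k be a natural number, let n be a natural number, and suppose (aₘ) is a sequence of real numbers and ε > 0 is such that for all real z with |z| < ε one has Σ_{m} aₘ zᵐ = (1+z)/((1−2z·cos θ+z²)^{k+3/2}·(1−z)^{2k+2}) (with the positive real power of 1−2z·cos θ+z², which is > 0 for |z| < 1). Then aₙ ≤ (1/(2ᵏ (sin(θ/2))^{2k+3})) · Σ_{ℓ=0}^{k} C(k,ℓ)·C(n+k+ℓ+1, n), where C(·,·) denotes the binomial coefficient. -/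
open Real Finset

/-- The power series `p` has nonnegative coefficients, bounded above by those of `q`. -/
def PowerSeries.MajorizedBy (p q : PowerSeries ℝ) : Prop :=
  ∀ n, 0 ≤ PowerSeries.coeff n p ∧ PowerSeries.coeff n p ≤ PowerSeries.coeff n q

/-- The power series `p` converges absolutely at `z`, with sum `v`. -/
def PowerSeries.HasAbsEval (p : PowerSeries ℝ) (z v : ℝ) : Prop :=
  (Summable fun n => ‖PowerSeries.coeff n p * z ^ n‖) ∧
    HasSum (fun n => PowerSeries.coeff n p * z ^ n) v

namespace PowerSeries

theorem MajorizedBy.mul {p p' q q' : PowerSeries ℝ} (hp : p.MajorizedBy p')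
    (hq : q.MajorizedBy q') : (p * q).MajorizedBy (p' * q') := by
  intro n
  rw [coeff_mul, coeff_mul]
  exact ⟨sum_nonneg fun i _ => mul_nonneg (hp _).1 (hq _).1,
    sum_le_sum fun i _ =>
      mul_le_mul (hp _).2 (hq _).2 (hq _).1 ((hp _).1.trans (hp _).2)⟩

theorem MajorizedBy.pow {p p' : PowerSeries ℝ} (hp : p.MajorizedBy p') (k : ℕ) :
    (p ^ k).MajorizedBy (p' ^ k) := by
  induction k with
  | zero =>
    intro n
    simp only [pow_zero, coeff_one]
    split_ifs <;> norm_num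
  | succ k ih => simpa only [pow_succ] using ih.mul hp

theorem HasAbsEval.mul {p q : PowerSeries ℝ} {z v w : ℝ} (hp : p.HasAbsEval z v)
    (hq : q.HasAbsEval z w) : (p * q).HasAbsEval z (v * w) := by
  have key : (fun n => coeff n (p * q) * z ^ n) = fun n =>
      ∑ ij ∈ antidiagonal n, coeff ij.1 p * z ^ ij.1 * (coeff ij.2 q * z ^ ij.2) := by
    funext n
    rw [coeff_mul, sum_mul]
    refine sum_congr rfl fun ij hij => ?_
    rw [← mem_antidiagonal.1 hij, pow_add]
    ring
  have hs := summable_norm_sum_mul_antidiagonal_of_summable_norm hp.1 hq.1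
  have ht := tsum_mul_tsum_eq_tsum_sum_antidiagonal_of_summable_norm hp.1 hq.1
  rw [hp.2.tsum_eq, hq.2.tsum_eq] at ht
  have hn := funext fun n => congrArg norm (congrFun key n)
  rw [HasAbsEval, hn, key, ht]
  exact ⟨hs, hs.of_norm.hasSum⟩

theorem HasAbsEval.pow {p : PowerSeries ℝ} {z v : ℝ} (hp : p.HasAbsEval z v) (k : ℕ) :
    (p ^ k).HasAbsEval z (v ^ k) := by
  induction k with
  | zero =>
    have h : (fun n => coeff n (1 : PowerSeries ℝ) * z ^ n) = fun n => if n = 0 then 1 else 0 := by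
      funext n
      rw [coeff_one]
      split_ifs with hn <;> simp [hn]
    have hs : HasSum (fun n : ℕ => if n = 0 then (1 : ℝ) else 0) 1 := hasSum_ite_eq 0 1
    simp only [HasAbsEval, pow_zero]
    rw [h, funext fun n => congrArg norm (congrFun h n)]
    exact ⟨hs.summable.norm, hs⟩
  | succ k ih => simpa only [pow_succ] using ih.mul hp

theorem hasAbsEval_mk {a : ℕ → ℝ} {z v : ℝ} (h : HasSum (fun n => a n * z ^ n) v) :
    (mk a).HasAbsEval z v := by
  simp only [HasAbsEval, coeff_mk]
  exact ⟨h.summable.norm, h⟩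

end PowerSeries

theorem eq_of_hasSum_pow_eventually {a b : ℕ → ℝ} {f : ℝ → ℝ}
    (ha : ∀ᶠ z in nhds (0 : ℝ), HasSum (fun n => a n * z ^ n) (f z))
    (hb : ∀ᶠ z in nhds (0 : ℝ), HasSum (fun n => b n * z ^ n) (f z)) : a = b := by
  have key : ∀ c : ℕ → ℝ, (∀ᶠ z in nhds (0 : ℝ), HasSum (fun n => c n * z ^ n) (f z)) →
      HasFPowerSeriesAt f (FormalMultilinearSeries.ofScalars ℝ c) 0 := by
    intro c hc
    rw [hasFPowerSeriesAt_iff]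
    filter_upwards [hc] with z hz
    simpa [FormalMultilinearSeries.coeff_ofScalars, mul_comm] using hz
  funext n
  have h := congrArg (fun p => FormalMultilinearSeries.coeff p n)
    ((key a ha).eq_formalMultilinearSeries (key b hb))
  simpa [FormalMultilinearSeries.coeff_ofScalars] using h

theorem integral_inv_cos_sq_add_mul_sin_sq {r : ℝ} (hr : 0 < r) :
    ∫ x in (0 : ℝ)..π, (cos x ^ 2 + r ^ 2 * sin x ^ 2)⁻¹ = π / r := by
  have hpos : ∀ t : ℝ, 0 < t → ∀ x, 0 < cos x ^ 2 + t * sin x ^ 2 := by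
    intro t ht x
    have h := sin_sq_add_cos_sq x
    rcases eq_or_ne (sin x) 0 with h0 | h0
    · rw [h0] at h ⊢
      linarith
    · positivity
  have hQ := hpos r hr
  have hR := hpos (r ^ 2) (pow_pos hr 2)
  have hd : ∀ x ∈ Set.uIcc 0 π, HasDerivAt
      (fun x => (x + arctan ((r - 1) * (sin x * cos x) / (cos x ^ 2 + r * sin x ^ 2))) / r)
      (cos x ^ 2 + r ^ 2 * sin x ^ 2)⁻¹ x := by
    intro x _
    have hN := ((hasDerivAt_sin x).mul (hasDerivAt_cos x)).const_mul (r - 1)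
    have hD := ((hasDerivAt_cos x).pow 2).add (((hasDerivAt_sin x).pow 2).const_mul r)
    have h := ((hasDerivAt_id x).add ((hN.div hD (hQ x).ne').arctan)).div_const r
    refine h.congr_deriv ?_
    have h1 := sin_sq_add_cos_sq x
    have hQ' := (hQ x).ne'
    have hR' := (hR x).ne'
    simp only [Pi.add_apply, Pi.mul_apply, Pi.pow_apply, Pi.div_apply]
    set S := sin x
    set C := cos x
    have hsum : (C ^ 2 + r * S ^ 2) ^ 2 + ((r - 1) * (S * C)) ^ 2 = C ^ 2 + r ^ 2 * S ^ 2 := by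
      linear_combination (C ^ 2 + r ^ 2 * S ^ 2) * h1
    have hfrac : 1 + ((r - 1) * (S * C) / (C ^ 2 + r * S ^ 2)) ^ 2 =
        (C ^ 2 + r ^ 2 * S ^ 2) / (C ^ 2 + r * S ^ 2) ^ 2 := by
      rw [← hsum]
      field_simp
    rw [hfrac]
    field_simp
    push_cast
    linear_combination (r * (S ^ 2 + C ^ 2 + 1) - r ^ 2 * S ^ 2 - C ^ 2) * h1
  rw [intervalIntegral.integral_eq_sub_of_hasDerivAt hd]
  · simp
  · apply Continuous.intervalIntegrable
    exact Continuous.inv₀ (by fun_prop) fun x => (hR x).ne'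

section ChebyshevSquares

open Polynomial.Chebyshev

theorem sq_eval_chebyshev_U_mul_le {v : ℝ} (hv : v ^ 2 < 1) (n : ℕ) :
    (U ℝ n).eval v ^ 2 ≤ (1 - v ^ 2)⁻¹ := by
  obtain ⟨h1, h2⟩ := abs_lt.1 ((sq_lt_one_iff_abs_lt_one v).1 hv)
  have h := U_real_cos (arccos v) n
  rw [cos_arccos h1.le h2.le] at h
  have hs : sin (arccos v) ^ 2 = 1 - v ^ 2 := by
    rw [sin_arccos, sq_sqrt (by linarith)]
  rw [← one_div, le_div_iff₀ (by linarith), ← hs, ← mul_pow, h]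
  exact sin_sq_le_one _

theorem hasSum_sq_eval_chebyshev_U {v z : ℝ} (hv : v ^ 2 < 1) (hz : |z| < 1)
    (hD : 0 < (1 + z) ^ 2 - 4 * z * v ^ 2) :
    HasSum (fun n : ℕ => (U ℝ n).eval v ^ 2 * z ^ n)
      ((1 + z) / ((1 - z) * ((1 + z) ^ 2 - 4 * z * v ^ 2))) := by
  have hs : Summable fun n : ℕ => (U ℝ n).eval v ^ 2 * z ^ n := by
    refine Summable.of_norm_bounded
      ((summable_geometric_of_lt_one (abs_nonneg z) hz).mul_left (1 - v ^ 2)⁻¹) fun n => ?_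
    rw [norm_mul, norm_pow z, norm_of_nonneg (sq_nonneg _), norm_eq_abs]
    exact mul_le_mul_of_nonneg_right (sq_eval_chebyshev_U_mul_le hv n) (by positivity)
  have hrec : ∀ n : ℕ, (U ℝ ((n + 2 : ℕ) : ℤ)).eval v =
      2 * v * (U ℝ ((n + 1 : ℕ) : ℤ)).eval v - (U ℝ n).eval v := by
    intro n
    push_cast
    simp
  have h3 : ∀ n : ℕ, (U ℝ ((n + 3 : ℕ) : ℤ)).eval v ^ 2 * z ^ (n + 3) =
      (4 * v ^ 2 - 1) * z * ((U ℝ ((n + 2 : ℕ) : ℤ)).eval v ^ 2 * z ^ (n + 2)) -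
      (4 * v ^ 2 - 1) * z ^ 2 * ((U ℝ ((n + 1 : ℕ) : ℤ)).eval v ^ 2 * z ^ (n + 1)) +
      z ^ 3 * ((U ℝ n).eval v ^ 2 * z ^ n) := by
    intro n
    rw [hrec (n + 1), hrec n]
    ring
  have H := hs.hasSum
  set T := ∑' n : ℕ, (U ℝ n).eval v ^ 2 * z ^ n
  have s1 := (hasSum_nat_add_iff' 1).2 H
  have s2 := (hasSum_nat_add_iff' 2).2 H
  have s3 := (hasSum_nat_add_iff' 3).2 H
  have s3' := ((s2.mul_left ((4 * v ^ 2 - 1) * z)).sub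
    (s1.mul_left ((4 * v ^ 2 - 1) * z ^ 2))).add (H.mul_left (z ^ 3))
  have e := s3.unique (funext h3 ▸ s3')
  have u2 : (U ℝ 2).eval v = 4 * v ^ 2 - 1 := by
    have h := hrec 0
    simp only [Nat.cast_ofNat, zero_add, Nat.cast_one, Nat.cast_zero, U_one, U_zero] at h
    rw [h]
    simp
    ring
  simp [sum_range_succ, u2] at e
  have hz1 : 0 < 1 - z := by linarith [(abs_lt.1 hz).2]
  have : T = (1 + z) / ((1 - z) * ((1 + z) ^ 2 - 4 * z * v ^ 2)) := by
    rw [eq_div_iff (by positivity)]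
    linear_combination e
  rw [← this]
  exact H

theorem one_add_sq_sub_pos {v z : ℝ} (hv : v ^ 2 < 1) (hz : |z| < 1) :
    0 < (1 + z) ^ 2 - 4 * z * v ^ 2 := by
  obtain ⟨h1, h2⟩ := abs_lt.1 hz
  rcases le_total z 0 with h | h
  · nlinarith [sq_nonneg v, mul_nonneg (neg_nonneg.2 h) (sq_nonneg v)]
  · nlinarith [mul_nonneg h (sub_nonneg.2 hv.le)]

/-- Sums of Legendre polynomials at `2 * c ^ 2 - 1`, written as an average of squares. -/
noncomputable def legendreSum (c : ℝ) (n : ℕ) : ℝ :=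
  π⁻¹ * ∫ x in (0 : ℝ)..π, (U ℝ n).eval (c * sin x) ^ 2

theorem mul_sin_sq_le (c x : ℝ) : (c * sin x) ^ 2 ≤ c ^ 2 := by
  rw [mul_pow]
  exact mul_le_of_le_one_right (sq_nonneg c) (sin_sq_le_one x)

theorem legendreSum_nonneg (c : ℝ) (n : ℕ) : 0 ≤ legendreSum c n :=
  mul_nonneg (inv_nonneg.2 pi_pos.le)
    (intervalIntegral.integral_nonneg pi_pos.le fun _ _ => sq_nonneg _)

theorem legendreSum_le {c s : ℝ} (hs : 0 < s) (hcs : s ^ 2 + c ^ 2 = 1) (n : ℕ) :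
    legendreSum c n ≤ 1 / s := by
  have hv : ∀ x, (c * sin x) ^ 2 < 1 := fun x =>
    (mul_sin_sq_le c x).trans_lt (by nlinarith)
  have hpt : ∀ x, (1 - (c * sin x) ^ 2)⁻¹ = (cos x ^ 2 + s ^ 2 * sin x ^ 2)⁻¹ := by
    intro x
    congr 1
    linear_combination -(sin x ^ 2) * hcs - sin_sq_add_cos_sq x
  have hle : ∫ x in (0 : ℝ)..π, (U ℝ n).eval (c * sin x) ^ 2 ≤
      ∫ x in (0 : ℝ)..π, (cos x ^ 2 + s ^ 2 * sin x ^ 2)⁻¹ := by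
    refine intervalIntegral.integral_mono_on pi_pos.le
      (Continuous.intervalIntegrable (by fun_prop) _ _)
      (Continuous.intervalIntegrable (Continuous.inv₀ (by fun_prop) fun x => ?_) _ _)
      fun x _ => hpt x ▸ sq_eval_chebyshev_U_mul_le (hv x) n
    have := hv x
    have h := inv_pos.2 (sub_pos.2 this)
    rw [hpt] at h
    exact (inv_pos.1 h).ne'
  rw [integral_inv_cos_sq_add_mul_sin_sq hs] at hle
  calc legendreSum c n ≤ π⁻¹ * (π / s) :=
        mul_le_mul_of_nonneg_left hle (inv_nonneg.2 pi_pos.le)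
    _ = 1 / s := by field_simp

theorem hasSum_legendreSum {c z : ℝ} (hc : c ^ 2 < 1) (hz : |z| < 1) :
    HasSum (fun n => legendreSum c n * z ^ n)
      (1 / ((1 - z) * √((1 + z) ^ 2 - 4 * z * c ^ 2))) := by
  have hv : ∀ x, (c * sin x) ^ 2 < 1 := fun x => (mul_sin_sq_le c x).trans_lt hc
  have hc' : 0 < 1 - c ^ 2 := by linarith
  obtain ⟨hz1, hz2⟩ := abs_lt.1 hz
  have h1z : 0 < 1 + z := by linarith
  have h2z : 0 < 1 - z := by linarith
  have hD := one_add_sq_sub_pos hc hz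
  have hsum : HasSum (fun n : ℕ => ∫ x in (0 : ℝ)..π, (U ℝ n).eval (c * sin x) ^ 2 * z ^ n)
      (∫ x in (0 : ℝ)..π,
        (1 + z) / ((1 - z) * ((1 + z) ^ 2 - 4 * z * (c * sin x) ^ 2))) := by
    refine intervalIntegral.hasSum_integral_of_dominated_convergence
      (fun n _ => (1 - c ^ 2)⁻¹ * |z| ^ n) (fun n => ?_) (fun n => ?_) ?_ ?_ ?_
    · exact Continuous.aestronglyMeasurable (by fun_prop)
    · refine Filter.Eventually.of_forall fun x _ => ?_
      rw [norm_mul, norm_pow z, norm_of_nonneg (sq_nonneg _), norm_eq_abs]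
      refine mul_le_mul_of_nonneg_right ?_ (by positivity)
      refine (sq_eval_chebyshev_U_mul_le (hv x) n).trans ?_
      exact inv_anti₀ hc' (by linarith [mul_sin_sq_le c x])
    · exact Filter.Eventually.of_forall fun x _ =>
        (summable_geometric_of_lt_one (abs_nonneg z) hz).mul_left _
    · exact intervalIntegrable_const
    · exact Filter.Eventually.of_forall fun x _ =>
        hasSum_sq_eval_chebyshev_U (hv x) hz (one_add_sq_sub_pos (hv x) hz)
  set R := √((1 + z) ^ 2 - 4 * z * c ^ 2) with hRdef
  have hR : 0 < R := sqrt_pos.2 hD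
  have hR2 : R ^ 2 = (1 + z) ^ 2 - 4 * z * c ^ 2 := sq_sqrt hD.le
  have hint : (∫ x in (0 : ℝ)..π,
      (1 + z) / ((1 - z) * ((1 + z) ^ 2 - 4 * z * (c * sin x) ^ 2))) =
      π * (1 / ((1 - z) * R)) := by
    have hpt : ∀ x, (1 + z) / ((1 - z) * ((1 + z) ^ 2 - 4 * z * (c * sin x) ^ 2)) =
        ((1 - z) * (1 + z))⁻¹ * (cos x ^ 2 + (R / (1 + z)) ^ 2 * sin x ^ 2)⁻¹ := by
      intro x
      have e : cos x ^ 2 + (R / (1 + z)) ^ 2 * sin x ^ 2 =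
          ((1 + z) ^ 2 - 4 * z * (c * sin x) ^ 2) / (1 + z) ^ 2 := by
        rw [div_pow, hR2, eq_div_iff (by positivity)]
        field_simp
        linear_combination (1 + z) ^ 2 * sin_sq_add_cos_sq x
      have := one_add_sq_sub_pos (hv x) hz
      rw [e]
      field_simp
    rw [funext hpt, intervalIntegral.integral_const_mul,
      integral_inv_cos_sq_add_mul_sin_sq (by positivity)]
    field_simp
  rw [hint] at hsum
  have h := hsum.mul_left π⁻¹
  rw [inv_mul_cancel_left₀ pi_pos.ne'] at h
  simpa only [legendreSum, intervalIntegral.integral_mul_const, mul_assoc] using h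

end ChebyshevSquares

/-- The power series of `1 / (1 - z ^ 2)`. -/
noncomputable def evenSeries : PowerSeries ℝ := PowerSeries.mk fun n => (1 + (-1) ^ n) / 2

theorem hasAbsEval_evenSeries {z : ℝ} (hz : |z| < 1) :
    evenSeries.HasAbsEval z (1 / (1 - z ^ 2)) := by
  obtain ⟨hz1, hz2⟩ := abs_lt.1 hz
  have h1z : 0 < 1 + z := by linarith
  have h2z : 0 < 1 - z := by linarith
  refine PowerSeries.hasAbsEval_mk ?_
  have h := ((hasSum_geometric_of_norm_lt_one (ξ := z) hz).add
    (hasSum_geometric_of_norm_lt_one (ξ := -z) (by rwa [norm_neg]))).mul_left (1 / 2)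
  have e : (1 / 2) * ((1 - z)⁻¹ + (1 - -z)⁻¹) = 1 / (1 - z ^ 2) := by
    have : 1 - z ^ 2 = (1 - z) * (1 + z) := by ring
    rw [this, sub_neg_eq_add]
    field_simp
    ring
  rw [e] at h
  have hn : ∀ n : ℕ, (1 + (-1) ^ n) / 2 * z ^ n = 1 / 2 * (z ^ n + (-z) ^ n) := fun n => by
    rw [neg_pow z]
    ring
  simpa only [hn] using h

theorem evenSeries_majorizedBy : evenSeries.MajorizedBy evenSeries := by
  refine fun n => ⟨?_, le_rfl⟩
  rw [evenSeries, PowerSeries.coeff_mk]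
  rcases neg_one_pow_eq_or ℝ n with h | h <;> rw [h] <;> norm_num

theorem mk_one_mul_evenSeries_majorizedBy :
    (PowerSeries.mk 1 * evenSeries).MajorizedBy
      ((1 / 2 : ℝ) • (PowerSeries.mk 1 * (1 + PowerSeries.mk 1))) := by
  have hone : (PowerSeries.mk 1 : PowerSeries ℝ).MajorizedBy (PowerSeries.mk 1) := by
    intro n
    simp
  refine fun n => ⟨(hone.mul evenSeries_majorizedBy n).1, ?_⟩
  have h1 : PowerSeries.coeff n (PowerSeries.mk 1 * evenSeries) =
      ((n + 1 : ℕ) + ∑ i ∈ range (n + 1), (-1 : ℝ) ^ i) / 2 := by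
    rw [mul_comm, PowerSeries.coeff_mul, Nat.sum_antidiagonal_eq_sum_range_succ_mk]
    simp [evenSeries, ← sum_div, sum_add_distrib]
  have h2 : PowerSeries.coeff n
      ((1 / 2 : ℝ) • (PowerSeries.mk 1 * (1 + PowerSeries.mk 1) : PowerSeries ℝ)) =
      ((n + 1 : ℕ) + 1) / 2 := by
    rw [mul_add, mul_one, ← sq, PowerSeries.mk_one_pow_eq_mk_choose_add]
    simp
    ring
  rw [h1, h2, neg_one_geom_sum]
  split_ifs <;> linarith

theorem PowerSeries.MajorizedBy.trans {p q r : PowerSeries ℝ} (hpq : p.MajorizedBy q)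
    (hqr : q.MajorizedBy r) : p.MajorizedBy r :=
  fun n => ⟨(hpq n).1, (hpq n).2.trans (hqr n).2⟩

theorem PowerSeries.MajorizedBy.smul {p q : PowerSeries ℝ} (hpq : p.MajorizedBy q) {c : ℝ}
    (hc : 0 ≤ c) : (c • p).MajorizedBy (c • q) := by
  intro n
  simp only [PowerSeries.coeff_smul, smul_eq_mul]
  exact ⟨mul_nonneg hc (hpq n).1, mul_le_mul_of_nonneg_left (hpq n).2 hc⟩

theorem PowerSeries.mk_majorizedBy_smul_mk_one {a : ℕ → ℝ} {c : ℝ} (h0 : ∀ n, 0 ≤ a n)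
    (h : ∀ n, a n ≤ c) : (mk a).MajorizedBy (c • mk 1) := by
  intro n
  simpa using ⟨h0 n, h n⟩

theorem PowerSeries.coeff_mk_one_pow_mul_one_add_mk_one_pow (k n : ℕ) :
    coeff n (mk 1 ^ (k + 2) * (1 + mk 1) ^ k : PowerSeries ℝ) =
      ∑ l ∈ range (k + 1), (k.choose l : ℝ) * ((n + k + l + 1).choose n : ℝ) := by
  rw [add_comm (1 : PowerSeries ℝ), add_pow, mul_sum, map_sum]
  refine sum_congr rfl fun l _ => ?_
  have e : (mk 1 ^ (k + 2) * (mk 1 ^ l * 1 ^ (k - l) * (k.choose l : PowerSeries ℝ))) =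
      (k.choose l : ℝ) • mk 1 ^ (k + l + 1 + 1) := by
    rw [one_pow, smul_eq_C_mul, map_natCast]
    ring
  rw [e, mk_one_pow_eq_mk_choose_add, coeff_smul, coeff_mk, smul_eq_mul,
    show n + k + l + 1 = k + l + 1 + n by ring, Nat.choose_symm_add]

open Polynomial.Chebyshev in
theorem kogbetliantz_majorizedBy {c s : ℝ} (hs : 0 < s) (hcs : s ^ 2 + c ^ 2 = 1) (k : ℕ) :
    let f : PowerSeries ℝ := PowerSeries.mk fun n : ℕ => (U ℝ n).eval c ^ 2
    (f * PowerSeries.mk (legendreSum c) * (f * evenSeries) ^ k).MajorizedBy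
      ((1 / (2 ^ k * s ^ (2 * k + 3))) •
        (PowerSeries.mk 1 ^ (k + 2) * (1 + PowerSeries.mk 1) ^ k)) := by
  intro f
  have hc : c ^ 2 < 1 := by nlinarith
  have hf : f.MajorizedBy ((1 / s ^ 2) • PowerSeries.mk 1) := by
    refine PowerSeries.mk_majorizedBy_smul_mk_one (fun n => sq_nonneg _) fun n => ?_
    have h := sq_eval_chebyshev_U_mul_le hc n
    rwa [show 1 - c ^ 2 = s ^ 2 by linarith, ← one_div] at h
  have hL : (PowerSeries.mk (legendreSum c)).MajorizedBy ((1 / s) • PowerSeries.mk 1) :=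
    PowerSeries.mk_majorizedBy_smul_mk_one (legendreSum_nonneg c) (legendreSum_le hs hcs)
  have hE := hf.mul evenSeries_majorizedBy
  rw [smul_mul_assoc] at hE
  have hE' := hE.trans (mk_one_mul_evenSeries_majorizedBy.smul (by positivity))
  have h := (hf.mul hL).mul (hE'.pow k)
  have e : (1 / (2 ^ k * s ^ (2 * k + 3))) = 1 / s ^ 2 * (1 / s) * (1 / s ^ 2 * (1 / 2)) ^ k := by
    rw [one_div_mul_one_div, one_div_mul_one_div, one_div_pow, one_div_mul_one_div]
    congr 1
    ring
  convert h using 1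
  rw [e]
  simp only [PowerSeries.smul_eq_C_mul, map_mul, map_pow, mul_pow]
  ring

open Polynomial.Chebyshev in
theorem kogbetliantz_hasAbsEval {c z : ℝ} (hc : c ^ 2 < 1) (hz : |z| < 1) (k : ℕ) :
    let f : PowerSeries ℝ := PowerSeries.mk fun n : ℕ => (U ℝ n).eval c ^ 2
    (f * PowerSeries.mk (legendreSum c) * (f * evenSeries) ^ k).HasAbsEval z
      ((1 + z) /
        (((1 + z) ^ 2 - 4 * z * c ^ 2) ^ ((k : ℝ) + 3 / 2) * (1 - z) ^ (2 * k + 2))) := by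
  intro f
  obtain ⟨hz1, hz2⟩ := abs_lt.1 hz
  have h1z : 0 < 1 + z := by linarith
  have h2z : 0 < 1 - z := by linarith
  have hD := one_add_sq_sub_pos hc hz
  have hf : f.HasAbsEval z _ := PowerSeries.hasAbsEval_mk (hasSum_sq_eval_chebyshev_U hc hz hD)
  have h := (hf.mul (PowerSeries.hasAbsEval_mk (hasSum_legendreSum hc hz))).mul
    ((hf.mul (hasAbsEval_evenSeries hz)).pow k)
  convert h using 1
  set D := (1 + z) ^ 2 - 4 * z * c ^ 2
  have hR : 0 < √D := sqrt_pos.2 hD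
  have hpow : D ^ ((k : ℝ) + 3 / 2) = D ^ (k + 1) * √D := by
    rw [sqrt_eq_rpow, ← rpow_natCast, ← rpow_add hD]
    congr 1
    push_cast
    ring
  have hbase : (1 + z) / ((1 - z) * D) * (1 / (1 - z ^ 2)) = 1 / ((1 - z) ^ 2 * D) := by
    rw [show 1 - z ^ 2 = (1 - z) * (1 + z) by ring]
    field_simp
  rw [hpow, hbase, div_pow, one_pow, mul_pow, ← pow_mul]
  field_simp
  ring

/-- Half-integer case of Theorem 1: if
Σ aₘ zᵐ = (1+z)/((1−2z·cos θ+z²)^{k+3/2}·(1−z)^{2k+2}) for all |z| < ε, then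
aₙ ≤ (1/(2ᵏ (sin(θ/2))^{2k+3})) · Σ_{ℓ=0}^{k} C(k,ℓ)·C(n+k+ℓ+1, n). -/
theorem kogbetliantz_half_integer_bound (θ : ℝ) (hθ : 0 < θ) (hθ' : θ ≤ Real.pi)
    (k n : ℕ) (a : ℕ → ℝ) (ε : ℝ) (hε : 0 < ε)
    (ha : ∀ z : ℝ, |z| < ε →
      HasSum (fun m : ℕ => a m * z ^ m)
        ((1 + z) /
          ((1 - 2 * z * Real.cos θ + z ^ 2) ^ ((k : ℝ) + 3 / 2) * (1 - z) ^ (2 * k + 2)))) :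
    a n ≤ 1 / (2 ^ k * Real.sin (θ / 2) ^ (2 * k + 3)) *
        ∑ l ∈ Finset.range (k + 1), (k.choose l : ℝ) * ((n + k + l + 1).choose n : ℝ) := by
  have hs : 0 < Real.sin (θ / 2) := sin_pos_of_pos_of_lt_pi (by linarith) (by linarith)
  have hcs := sin_sq_add_cos_sq (θ / 2)
  have hc : Real.cos (θ / 2) ^ 2 < 1 := by nlinarith
  have hcos : Real.cos θ = 2 * Real.cos (θ / 2) ^ 2 - 1 := by
    rw [← cos_two_mul]
    congr 1
    ring
  have hev : ∀ r : ℝ, 0 < r → ∀ᶠ z in nhds (0 : ℝ), |z| < r := fun r hr => by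
    filter_upwards [Metric.ball_mem_nhds (0 : ℝ) hr] with z hz
    simpa using hz
  have key := eq_of_hasSum_pow_eventually ((hev ε hε).mono ha) ((hev 1 one_pos).mono fun z hz => by
    rw [show 1 - 2 * z * Real.cos θ + z ^ 2 = (1 + z) ^ 2 - 4 * z * Real.cos (θ / 2) ^ 2 by
      rw [hcos]; ring]
    exact (kogbetliantz_hasAbsEval hc hz k).2)
  have h := (kogbetliantz_majorizedBy hs hcs k n).2
  rw [PowerSeries.coeff_smul, PowerSeries.coeff_mk_one_pow_mul_one_add_mk_one_pow] at h
  rw [key]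
  exact h
end

section
/- For every real number t ≠ 0, sin(t)/t ≥ −0.2173. -/
open Real in
/-- The tangent-type bound `cos u + 0.2173 u ≤ 1.024` to the left of `π / 2`. -/
theorem cos_add_mul_le {u : ℝ} (hu : u ≤ π / 2) : cos u + 0.2173 * u ≤ 1.024 := by
  rcases le_or_gt u 0 with h0 | h0
  · linarith [cos_le_one u]
  rcases le_or_gt u 1 with h1 | h1
  · have h := (abs_le.1 (cos_bound (x := u) (by rw [abs_of_pos h0]; exact h1))).2
    rw [abs_of_pos h0] at h
    have key : 0 ≤ (1 - u) * (1 + u) * (u - 0.22) ^ 2 :=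
      mul_nonneg (mul_nonneg (by linarith) (by linarith)) (sq_nonneg _)
    nlinarith [key, sq_nonneg (u - 0.22), mul_nonneg h0.le (sq_nonneg (u - 0.22))]
  · have hc : cos u ≤ cos 1 :=
      cos_le_cos_of_nonneg_of_le_pi zero_le_one (by linarith [pi_pos]) h1.le
    linarith [cos_one_le, pi_lt_d2]

open Real in
theorem sin_add_mul_nonneg {t : ℝ} (ht : 0 ≤ t) : 0 ≤ sin t + 0.2173 * t := by
  rcases le_or_gt t π with h | h
  · linarith [sin_nonneg_of_nonneg_of_le_pi ht h]
  · have hu := cos_add_mul_le (u := 3 * π / 2 - t) (by linarith)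
    have hs : cos (3 * π / 2 - t) = -sin t := by
      rw [show 3 * π / 2 - t = π / 2 - t + π by ring, cos_add_pi, cos_pi_div_two_sub]
    rw [hs] at hu
    linarith [pi_gt_d6]

/-- For every real t ≠ 0, sin(t)/t ≥ −0.2173. -/
theorem sinc_lower_bound (t : ℝ) (ht : t ≠ 0) : Real.sin t / t ≥ -0.2173 := by
  rcases lt_or_gt_of_ne ht with h | h
  · have h2 := sin_add_mul_nonneg (neg_nonneg.2 h.le)
    rw [Real.sin_neg] at h2
    rw [ge_iff_le, le_div_iff_of_neg h]
    linarith
  · rw [ge_iff_le, le_div_iff₀ h]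
    linarith [sin_add_mul_nonneg h.le]
end

section
/- Let θ ∈ ℝ with 0 < θ ≤ π and let n be a natural number. Then 1 − cos(θ/2)·sin((n+1)θ)/(2(n+1)·sin(θ/2)) ≤ 1.2173. -/
open Real

/-- A linear upper bound for cosine, tight up to `3e-4` near `u = 0.219`. -/
lemma cos_le_mul_three_pi_div_two_sub {u : ℝ} (hu : u ≤ π / 2) :
    cos u ≤ 0.2173 * (3 * π / 2 - u) := by
  have hpi := pi_gt_d4
  rcases le_total u 0 with h0 | h0
  · linarith [cos_le_one u]
  rcases le_total u 1 with h1 | h1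
  · have hb := (abs_le.1 (cos_bound (x := u) (by rwa [abs_of_nonneg h0]))).2
    rw [abs_of_nonneg h0] at hb
    have hu2 : u ^ 2 ≤ 1 := by nlinarith
    nlinarith [mul_nonneg (sq_nonneg (u - 0.219))
      (show (0 : ℝ) ≤ 1 / 2 - 5 / 96 * (u ^ 2 + 2 * 0.219 * u + 3 * 0.219 ^ 2) by linarith)]
  · have hb := (abs_le.1 (cos_bound (x := 1) (by simp))).2
    have hc : cos u ≤ cos 1 :=
      cos_le_cos_of_nonneg_of_le_pi zero_le_one (by linarith) h1
    norm_num at hb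
    linarith

/-- The lower bound `sinc t ≥ -0.2173` on the positive half-line, cleared of its denominator. -/
lemma neg_mul_le_sin {t : ℝ} (ht : 0 ≤ t) : -(0.2173 * t) ≤ sin t := by
  rcases le_total t π with h | h
  · linarith [sin_nonneg_of_nonneg_of_le_pi ht h]
  · have hc := cos_le_mul_three_pi_div_two_sub (u := 3 * π / 2 - t) (by linarith)
    have he : cos (3 * π / 2 - t) = -sin t := by
      rw [show 3 * π / 2 - t = π / 2 - t + π by ring, cos_add_pi, cos_pi_div_two_sub]
    rw [he] at hc
    linarith

lemma mul_cos_le_sin {x : ℝ} (h0 : 0 ≤ x) (hx : x ≤ π / 2) : x * cos x ≤ sin x := by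
  rcases hx.eq_or_lt with rfl | h
  · simp
  · have hc : 0 < cos x := cos_pos_of_mem_Ioo ⟨by linarith [pi_pos], h⟩
    have ht := le_tan h0 h
    rwa [tan_eq_sin_div_cos, le_div_iff₀ hc] at ht

/-- For 0 < θ ≤ π and n ∈ ℕ, 1 − cos(θ/2)·sin((n+1)θ)/(2(n+1)·sin(θ/2)) ≤ 1.2173. -/
theorem S_one_factor_bound (θ : ℝ) (hθ : 0 < θ) (hθ' : θ ≤ Real.pi) (n : ℕ) :
    1 - Real.cos (θ / 2) * Real.sin ((n + 1 : ℝ) * θ) /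
        (2 * (n + 1 : ℝ) * Real.sin (θ / 2)) ≤ 1.2173 := by
  have hN : (0 : ℝ) < n + 1 := by positivity
  have hs : 0 < sin (θ / 2) := sin_pos_of_pos_of_lt_pi (by linarith) (by linarith)
  have hc : 0 ≤ cos (θ / 2) := cos_nonneg_of_mem_Icc ⟨by linarith, by linarith⟩
  have h1 := mul_le_mul_of_nonneg_left (neg_mul_le_sin (mul_pos hN hθ).le) hc
  have h2 := mul_le_mul_of_nonneg_left
    (mul_cos_le_sin (x := θ / 2) (by linarith) (by linarith)) hN.le
  have key : -0.2173 ≤ cos (θ / 2) * sin ((n + 1 : ℝ) * θ) /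
      (2 * (n + 1 : ℝ) * sin (θ / 2)) := by
    rw [le_div_iff₀ (by positivity)]
    linarith
  linarith
end

section
/- Let θ ∈ ℝ with 0 < θ < π. Then (√2/π)·∫_θ^{π} cos(t/2)/(√(cos θ − cos t)·sin(t/2)) dt = (π−θ)/(π·sin(θ/2)), and in particular this quantity is at most 1/sin(θ/2). -/
open Real intervalIntegral

/-- For `0 < θ < t < π`, an antiderivative in `t` of
`cos (t / 2) / (√(cos θ - cos t) * sin (t / 2))`. -/
theorem hasDerivAt_arccos_sin_half_div_sin_half {θ t : ℝ} (hθ : 0 < θ) (ht : θ < t)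
    (htπ : t < π) :
    HasDerivAt (fun x ↦ √2 / sin (θ / 2) * arccos (sin (θ / 2) / sin (x / 2)))
      (cos (t / 2) / (√(cos θ - cos t) * sin (t / 2))) t := by
  have ha : 0 < sin (θ / 2) := sin_pos_of_pos_of_lt_pi (by linarith) (by linarith)
  have hs : sin (θ / 2) < sin (t / 2) :=
    sin_lt_sin_of_lt_of_le_pi_div_two (by linarith) (by linarith) (by linarith)
  have hs0 : 0 < sin (t / 2) := ha.trans hs
  have hu0 : 0 < sin (θ / 2) / sin (t / 2) := by positivity
  have hu1 : sin (θ / 2) / sin (t / 2) < 1 := (div_lt_one hs0).2 hs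
  have hpos : 0 < 1 - (sin (θ / 2) / sin (t / 2)) ^ 2 := by nlinarith
  have hsqrt : √(cos θ - cos t) =
      √2 * (sin (t / 2) * √(1 - (sin (θ / 2) / sin (t / 2)) ^ 2)) := by
    have h : cos θ - cos t =
        2 * (sin (t / 2) ^ 2 * (1 - (sin (θ / 2) / sin (t / 2)) ^ 2)) := by
      have h₁ : cos θ = 1 - 2 * sin (θ / 2) ^ 2 := by
        rw [← cos_two_mul_eq_one_sub]; ring_nf
      have h₂ : cos t = 1 - 2 * sin (t / 2) ^ 2 := by
        rw [← cos_two_mul_eq_one_sub]; ring_nf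
      rw [h₁, h₂]
      field_simp
      ring
    rw [h, sqrt_mul (by norm_num), sqrt_mul (by positivity), sqrt_sq hs0.le]
  have hsin : HasDerivAt (fun x : ℝ ↦ sin (x / 2)) (cos (t / 2) * (1 / 2)) t :=
    ((hasDerivAt_id t).div_const 2).sin
  have hder := ((hasDerivAt_arccos (by linarith) hu1.ne).comp t
    ((hasDerivAt_const t (sin (θ / 2))).div hsin hs0.ne')).const_mul (√2 / sin (θ / 2))
  refine hder.congr_deriv ?_
  have hr : √(1 - (sin (θ / 2) / sin (t / 2)) ^ 2) ≠ 0 := (sqrt_pos.2 hpos).ne'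
  rw [hsqrt]
  generalize √(1 - (sin (θ / 2) / sin (t / 2)) ^ 2) = r at hr ⊢
  have h2 : √2 ^ 2 = 2 := sq_sqrt (by norm_num)
  field_simp
  linear_combination sin (θ / 2) * cos (t / 2) * h2

theorem integral_cos_half_div_sqrt_cos_sub_cos_mul_sin_half {θ : ℝ} (hθ : 0 < θ)
    (hθ' : θ < π) :
    ∫ t in θ..π, cos (t / 2) / (√(cos θ - cos t) * sin (t / 2)) =
      √2 / sin (θ / 2) * ((π - θ) / 2) := by
  have hsin {x : ℝ} (hx : θ ≤ x) (hxπ : x ≤ π) : 0 < sin (x / 2) :=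
    sin_pos_of_pos_of_lt_pi (by linarith) (by linarith)
  have ha := hsin le_rfl hθ'.le
  have hcont : ContinuousOn
      (fun x ↦ √2 / sin (θ / 2) * arccos (sin (θ / 2) / sin (x / 2))) (Set.Icc θ π) := by
    refine continuousOn_const.mul (continuous_arccos.comp_continuousOn
      (continuousOn_const.div (by fun_prop) fun x hx ↦ (hsin hx.1 hx.2).ne'))
  have hderiv (x : ℝ) (hx : x ∈ Set.Ioo θ π) :=
    hasDerivAt_arccos_sin_half_div_sin_half hθ hx.1 hx.2
  have hint : IntervalIntegrable
      (fun t ↦ cos (t / 2) / (√(cos θ - cos t) * sin (t / 2))) MeasureTheory.volume θ π := by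
    rw [intervalIntegrable_iff_integrableOn_Ioc_of_le hθ'.le]
    refine integrableOn_deriv_of_nonneg hcont hderiv fun x hx ↦ ?_
    have hc : 0 ≤ cos (x / 2) :=
      cos_nonneg_of_neg_pi_div_two_le_of_le (by linarith [hx.1]) (by linarith [hx.2])
    have := hsin hx.1.le hx.2.le
    positivity
  have harccos : arccos (sin (θ / 2)) = (π - θ) / 2 := by
    rw [← cos_pi_div_two_sub, arccos_cos (by linarith) (by linarith)]
    ring
  rw [integral_eq_sub_of_hasDerivAt_of_le hθ'.le hcont hderiv hint, div_self ha.ne',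
    sin_pi_div_two, div_one, arccos_one, harccos, mul_zero, sub_zero]

/-- For 0 < θ < π, (√2/π)·∫_θ^π cos(t/2)/(√(cos θ − cos t)·sin(t/2)) dt
= (π−θ)/(π·sin(θ/2)) ≤ 1/sin(θ/2). -/
theorem T_n_integral_identity (θ : ℝ) (hθ : 0 < θ) (hθ' : θ < Real.pi) :
    Real.sqrt 2 / Real.pi *
        ∫ t in θ..Real.pi,
          Real.cos (t / 2) / (Real.sqrt (Real.cos θ - Real.cos t) * Real.sin (t / 2)) =
      (Real.pi - θ) / (Real.pi * Real.sin (θ / 2)) ∧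
    Real.sqrt 2 / Real.pi *
        ∫ t in θ..Real.pi,
          Real.cos (t / 2) / (Real.sqrt (Real.cos θ - Real.cos t) * Real.sin (t / 2)) ≤
      1 / Real.sin (θ / 2) := by
  have ha : 0 < sin (θ / 2) := sin_pos_of_pos_of_lt_pi (by linarith) (by linarith)
  have h2 : √2 ^ 2 = 2 := sq_sqrt (by norm_num)
  have heq : √2 / π * ∫ t in θ..π, cos (t / 2) / (√(cos θ - cos t) * sin (t / 2)) =
      (π - θ) / (π * sin (θ / 2)) := by
    rw [integral_cos_half_div_sqrt_cos_sub_cos_mul_sin_half hθ hθ']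
    field_simp
    rw [h2]
  refine ⟨heq, heq.trans_le ?_⟩
  rw [div_le_div_iff₀ (by positivity) ha]
  nlinarith
end

section
/- Let θ ∈ ℝ with 0 < θ ≤ π, let k be a natural number, let n be a natural number, and suppose (aₘ) is a sequence of real numbers and ε > 0 is such that for all real z with |z| < ε one has Σ_{m} aₘ zᵐ = (1+z)^{2k+3}/((1−2z·cos θ+z²)^{k+3/2}·(1−z)^{2k+2}) (with the positive real power of 1−2z·cos θ+z², which is > 0 for |z| < 1). Then aₙ ≤ 4·(1.2173)^k·C(n+2k+1, n)/(sin(θ/2))^{2k+3}, where C(·,·) denotes the binomial coefficient. -/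
open Real Finset

namespace HalfIntegerKernel

open PowerSeries

/-- The quadratic `1 - 2 x z + z²` as a formal power series in `z`. -/
noncomputable def quadSeries (x : ℝ) : PowerSeries ℝ := 1 - C (2 * x) * X + X ^ 2

/-- The Legendre polynomials evaluated at `x`. -/
noncomputable def legendre (x : ℝ) : ℕ → ℝ
  | 0 => 1
  | 1 => x
  | (n + 2) => ((2 * n + 3) * x * legendre x (n + 1) - (n + 1) * legendre x n) / (n + 2)

/-- The generating series of the Legendre polynomials. -/
noncomputable def legendreSeries (x : ℝ) : PowerSeries ℝ := mk (legendre x)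

theorem legendre_recurrence (x : ℝ) (n : ℕ) :
    (n + 2) * legendre x (n + 2) = (2 * n + 3) * x * legendre x (n + 1) - (n + 1) * legendre x n := by
  have h : (n : ℝ) + 2 ≠ 0 := by positivity
  rw [legendre]
  field_simp

theorem coeff_quadSeries_mul_zero (x : ℝ) (A : PowerSeries ℝ) :
    coeff 0 (quadSeries x * A) = coeff 0 A := by
  simp [quadSeries]

theorem coeff_quadSeries_mul_one (x : ℝ) (A : PowerSeries ℝ) :
    coeff 1 (quadSeries x * A) = coeff 1 A - 2 * x * coeff 0 A := by
  have h : quadSeries x * A = A - C (2 * x) * (X * A) + X * (X * A) := by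
    rw [quadSeries]; ring
  rw [h, map_add, map_sub, coeff_C_mul, coeff_succ_X_mul, coeff_succ_X_mul]
  simp

theorem coeff_quadSeries_mul_add_two (x : ℝ) (A : PowerSeries ℝ) (n : ℕ) :
    coeff (n + 2) (quadSeries x * A) =
      coeff (n + 2) A - 2 * x * coeff (n + 1) A + coeff n A := by
  have h : quadSeries x * A = A - C (2 * x) * (X * A) + X * (X * A) := by
    rw [quadSeries]; ring
  rw [h, map_add, map_sub, coeff_C_mul, coeff_succ_X_mul, coeff_succ_X_mul, coeff_succ_X_mul]

theorem quadSeries_mul_derivative_legendreSeries (x : ℝ) :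
    quadSeries x * derivative ℝ (legendreSeries x) = (C x - X) * legendreSeries x := by
  ext n
  match n with
  | 0 =>
    simp [coeff_quadSeries_mul_zero, coeff_derivative, legendreSeries, legendre]
  | 1 =>
    rw [coeff_quadSeries_mul_one, sub_mul, map_sub, coeff_C_mul, coeff_succ_X_mul]
    have h := legendre_recurrence x 0
    simp only [coeff_derivative, legendreSeries, coeff_mk]
    simp only [legendre] at h ⊢
    push_cast at h ⊢
    linarith
  | n + 2 =>
    rw [coeff_quadSeries_mul_add_two, sub_mul, map_sub, coeff_C_mul, coeff_succ_X_mul]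
    have h := legendre_recurrence x (n + 1)
    simp only [coeff_derivative, legendreSeries, coeff_mk]
    push_cast at h ⊢
    linarith

theorem derivative_quadSeries (x : ℝ) : derivative ℝ (quadSeries x) = 2 * (X - C x) := by
  have h : derivative ℝ (C (2 * x)) = 0 := derivative_C
  have h2 : (C (2 * x) : PowerSeries ℝ) = 2 * C x := by
    rw [map_mul]; rfl
  simp only [quadSeries, map_add, map_sub, derivative_one, Derivation.leibniz,
    Derivation.leibniz_pow, h, derivative_X, smul_eq_mul, nsmul_eq_mul]
  rw [h2]
  push_cast
  ring

theorem legendreSeries_sq_mul_quadSeries (x : ℝ) :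
    legendreSeries x ^ 2 * quadSeries x = 1 := by
  apply derivative.ext
  · have h := quadSeries_mul_derivative_legendreSeries x
    rw [Derivation.leibniz, Derivation.leibniz_pow, derivative_quadSeries, derivative_one]
    simp only [smul_eq_mul, nsmul_eq_mul]
    push_cast
    linear_combination (2 * legendreSeries x) * h
  · simp [legendreSeries, quadSeries, legendre]

/-- The geometric series `1 / (1 - z)`. -/
noncomputable def geomSeries : PowerSeries ℝ := mk 1

theorem geomSeries_mul : geomSeries * (1 - X) = 1 := mk_one_mul_one_sub_eq_one ℝ

theorem coeff_geomSeries_pow (d n : ℕ) :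
    coeff n (geomSeries ^ (d + 1)) = ((d + n).choose d : ℝ) := by
  rw [geomSeries, mk_one_pow_eq_mk_choose_add, coeff_mk]

theorem coeff_mul_geomSeries (A : PowerSeries ℝ) (n : ℕ) :
    coeff n (A * geomSeries) = ∑ j ∈ range (n + 1), coeff j A := by
  rw [coeff_mul, Finset.Nat.sum_antidiagonal_eq_sum_range_succ_mk]
  simp [geomSeries]

theorem derivative_geomSeries : derivative ℝ geomSeries = geomSeries ^ 2 := by
  have h := congrArg (derivative ℝ) geomSeries_mul
  rw [Derivation.leibniz] at h
  simp only [smul_eq_mul, map_sub, derivative_one, derivative_X] at h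
  linear_combination geomSeries * h - (derivative ℝ geomSeries) * geomSeries_mul

/-- The series `∑_{m ≥ 1} cos (m θ) z ^ m`. -/
noncomputable def cosSeries (θ : ℝ) : PowerSeries ℝ :=
  mk fun m => if m = 0 then 0 else cos (m * θ)

theorem quadSeries_mul_cosSeries (θ : ℝ) :
    quadSeries (cos θ) * cosSeries θ = X * (C (cos θ) - X) := by
  ext n
  match n with
  | 0 => simp [coeff_quadSeries_mul_zero, cosSeries]
  | 1 =>
    rw [coeff_quadSeries_mul_one, coeff_succ_X_mul]
    simp [cosSeries]
  | 2 =>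
    rw [coeff_quadSeries_mul_add_two, coeff_succ_X_mul]
    simp [cosSeries, coeff_X, Real.cos_two_mul]
    ring
  | n + 3 =>
    rw [coeff_quadSeries_mul_add_two, coeff_succ_X_mul]
    simp only [cosSeries, coeff_mk, map_sub, coeff_C, coeff_X]
    simp only [Nat.add_eq_zero_iff, OfNat.ofNat_ne_zero, one_ne_zero, and_false, if_false]
    rw [if_neg (by omega)]
    have h1 : ((n + 1 + 2 : ℕ) : ℝ) * θ = ((n + 1 + 1 : ℕ) : ℝ) * θ + θ := by push_cast; ring
    have h2 : ((n + 1 : ℕ) : ℝ) * θ = ((n + 1 + 1 : ℕ) : ℝ) * θ - θ := by push_cast; ring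
    rw [h1, h2, cos_add, cos_sub]
    ring

theorem quadSeries_mul_sinSeries (θ : ℝ) :
    quadSeries (cos θ) * mk (fun m : ℕ => sin ((m + 1) * θ)) = C (sin θ) := by
  ext n
  match n with
  | 0 => simp [coeff_quadSeries_mul_zero]
  | 1 =>
    rw [coeff_quadSeries_mul_one]
    simp only [coeff_mk, coeff_C]
    have h1 : ((1 : ℕ) + 1 : ℝ) * θ = 2 * θ := by push_cast; ring
    rw [h1, sin_two_mul]
    simp
    ring
  | n + 2 =>
    rw [coeff_quadSeries_mul_add_two]
    simp only [coeff_mk, coeff_C]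
    have h1 : ((n + 2 : ℕ) + 1 : ℝ) * θ = ((n + 1 : ℕ) + 1 : ℝ) * θ + θ := by push_cast; ring
    have h2 : ((n : ℕ) + 1 : ℝ) * θ = ((n + 1 : ℕ) + 1 : ℝ) * θ - θ := by push_cast; ring
    rw [h1, h2, sin_add, sin_sub]
    simp
    ring

theorem sin_mul_coeff_legendreSeries_sq (θ : ℝ) (n : ℕ) :
    sin θ * coeff n (legendreSeries (cos θ) ^ 2) = sin ((n + 1) * θ) := by
  have h1 := quadSeries_mul_sinSeries θ
  have h2 := legendreSeries_sq_mul_quadSeries (cos θ)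
  have h3 : C (sin θ) * legendreSeries (cos θ) ^ 2 = mk (fun m : ℕ => sin ((m + 1) * θ)) := by
    linear_combination (-legendreSeries (cos θ) ^ 2) * h1 +
      mk (fun m : ℕ => sin ((m + 1) * θ)) * h2
  rw [← coeff_C_mul, h3, coeff_mk]

/-- A discrete analogue of Sonin's energy for the Legendre polynomials. -/
theorem legendre_energy_le (x : ℝ) (n : ℕ) :
    (legendre x (n + 1) - x * legendre x n) ^ 2 + (1 - x ^ 2) * legendre x n ^ 2 ≤ 1 - x ^ 2 := by
  induction n with
  | zero => simp [legendre]
  | succ n ih =>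
    refine le_trans ?_ ih
    have h := legendre_recurrence x n
    set a := legendre x n
    set b := legendre x (n + 1)
    have hc : legendre x (n + 2) = x * b - (n + 1) / (n + 2) * (a - x * b) := by
      have h : (n : ℝ) + 2 ≠ 0 := by positivity
      field_simp
      linarith
    rw [hc]
    have hr : ((n + 1) / (n + 2) : ℝ) ^ 2 ≤ 1 := by
      apply pow_le_one₀ (by positivity)
      rw [div_le_one (by positivity)]
      linarith
    nlinarith [mul_le_mul_of_nonneg_right hr (sq_nonneg (a - x * b))]

theorem abs_legendre_le_one {x : ℝ} (hx : x ^ 2 < 1) (n : ℕ) : |legendre x n| ≤ 1 := by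
  rw [← sq_le_one_iff_abs_le_one]
  have h := legendre_energy_le x n
  have h1 : 0 < 1 - x ^ 2 := by linarith
  nlinarith [sq_nonneg (legendre x (n + 1) - x * legendre x n)]

/-- Legendre differences at `x = cos θ`, where `s = sin (θ / 2)` and `c = cos (θ / 2)`. -/
theorem sq_mul_legendre_sub_le {x s c : ℝ} (hs : 0 < s) (hc : 0 ≤ c) (hsc : s ^ 2 + c ^ 2 = 1)
    (hx : x = 1 - 2 * s ^ 2) (n : ℕ) :
    c ^ 2 * (legendre x (n + 1) - legendre x n) ≤ 4 * s := by
  rcases hc.eq_or_lt with rfl | hc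
  · simp [hs.le]
  have hs1 : s ≤ 1 := by nlinarith
  have hc1 : c ≤ 1 := by nlinarith
  have hx1 : 1 - x ^ 2 = (2 * s * c) ^ 2 := by
    rw [hx]
    linear_combination (-4 * s ^ 2) * hsc
  have hpos : 0 < (2 * s * c) ^ 2 := by positivity
  have h1 := abs_legendre_le_one (x := x) (by linarith) n
  have h2 : legendre x (n + 1) - x * legendre x n ≤ 2 * s * c := by
    have h := legendre_energy_le x n
    rw [hx1] at h
    apply le_of_abs_le
    apply abs_le_of_sq_le_sq _ (by positivity)
    nlinarith [mul_nonneg hpos.le (sq_nonneg (legendre x n))]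
  have h3 := (abs_le.1 h1).1
  have h4 : legendre x (n + 1) - legendre x n ≤ 4 * s := by
    have : legendre x (n + 1) - legendre x n =
        (legendre x (n + 1) - x * legendre x n) - 2 * s ^ 2 * legendre x n := by
      rw [hx]; ring
    rw [this]
    nlinarith [mul_nonneg hs.le (sub_nonneg.2 hc1), mul_nonneg hs.le (sub_nonneg.2 hs1),
      mul_nonneg (sq_nonneg s) (by linarith : 0 ≤ legendre x n + 1)]
  calc c ^ 2 * (legendre x (n + 1) - legendre x n) ≤ c ^ 2 * (4 * s) := by gcongr
    _ ≤ 1 * (4 * s) := by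
        gcongr
        exact pow_le_one₀ hc.le hc1
    _ = 4 * s := one_mul _

/-- The series `1 / ((1 - z) √(1 - 2 z cos θ + z²))` has nonnegative coefficients. -/
theorem coeff_legendreSeries_mul_geomSeries_nonneg (θ : ℝ) (n : ℕ) :
    0 ≤ coeff n (legendreSeries (cos θ) * geomSeries) := by
  set p := legendreSeries (cos θ) with hp
  have hlog : X * derivative ℝ (p * geomSeries) =
      (cosSeries θ + X * geomSeries) * (p * geomSeries) := by
    have h1 : X * derivative ℝ p = cosSeries θ * p := by
      have h2 := quadSeries_mul_derivative_legendreSeries (cos θ)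
      have h3 := legendreSeries_sq_mul_quadSeries (cos θ)
      have h4 := quadSeries_mul_cosSeries θ
      rw [← hp] at h2 h3
      linear_combination (p ^ 2 * X) * h2 - p ^ 3 * h4 +
        (cosSeries θ * p - X * derivative ℝ p) * h3
    rw [Derivation.leibniz, derivative_geomSeries]
    simp only [smul_eq_mul]
    linear_combination geomSeries * h1
  have hL : ∀ m, 0 ≤ coeff m (cosSeries θ + X * geomSeries) := by
    intro m
    cases m with
    | zero => simp [cosSeries]
    | succ m =>
      rw [map_add, coeff_succ_X_mul]
      simp only [cosSeries, geomSeries, coeff_mk, Pi.one_apply]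
      rw [if_neg (by omega)]
      linarith [neg_one_le_cos (((m + 1 : ℕ) : ℝ) * θ)]
  induction n using Nat.strong_induction_on with
  | _ n ih =>
    cases n with
    | zero => simp [hp, legendreSeries, legendre, geomSeries]
    | succ n =>
      have h := congrArg (coeff (n + 1)) hlog
      rw [coeff_succ_X_mul, coeff_derivative, coeff_mul (n + 1) (cosSeries θ + _)] at h
      have hnn : 0 ≤ coeff (n + 1) (p * geomSeries) * ((n : ℝ) + 1) := by
        rw [h]
        refine Finset.sum_nonneg fun ij hij => ?_
        obtain ⟨i, j⟩ := ij
        rw [HasAntidiagonal.mem_antidiagonal] at hij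
        cases i with
        | zero => simp [cosSeries]
        | succ i => exact mul_nonneg (hL _) (ih j (by omega))
      exact nonneg_of_mul_nonneg_left hnn (by positivity)

theorem coeff_mul_nonneg {A B : PowerSeries ℝ} (hA : ∀ n, 0 ≤ coeff n A)
    (hB : ∀ n, 0 ≤ coeff n B) (n : ℕ) : 0 ≤ coeff n (A * B) := by
  rw [coeff_mul]
  exact Finset.sum_nonneg fun ij _ => mul_nonneg (hA _) (hB _)

theorem coeff_mul_le_coeff_mul {A B D : PowerSeries ℝ} (hAB : ∀ n, coeff n A ≤ coeff n B)
    (hD : ∀ n, 0 ≤ coeff n D) (n : ℕ) : coeff n (A * D) ≤ coeff n (B * D) := by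
  rw [coeff_mul, coeff_mul]
  exact Finset.sum_le_sum fun ij _ => mul_le_mul_of_nonneg_right (hAB _) (hD _)

theorem coeff_geomSeries_nonneg (n : ℕ) : 0 ≤ coeff n geomSeries := by
  simp [geomSeries]

theorem coeff_pow_nonneg {A : PowerSeries ℝ} (hA : ∀ n, 0 ≤ coeff n A) (k n : ℕ) :
    0 ≤ coeff n (A ^ k) := by
  induction k generalizing n with
  | zero =>
    rw [pow_zero, coeff_one]
    split_ifs <;> norm_num
  | succ k ih =>
    rw [pow_succ]
    exact coeff_mul_nonneg ih hA n

/-- The constant `0.2173` exceeds `- min (sin x / x)`. -/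
theorem neg_sin_le_mul {x : ℝ} (hx : 0 ≤ x) : -sin x ≤ 0.2173 * x := by
  have hpi := Real.pi_gt_d6
  rcases le_total x π with h | h
  · have := sin_nonneg_of_nonneg_of_le_pi hx h
    linarith
  rcases le_total 4.61 x with h' | h'
  · linarith [neg_one_le_sin x]
  obtain ⟨u, hu⟩ : ∃ u, u = 3 * π / 2 - x := ⟨_, rfl⟩
  have hsin : -sin x = cos u := by
    have : x = π + (π / 2 - u) := by rw [hu]; ring
    rw [this, sin_add, sin_pi, cos_pi, sin_pi_div_two_sub]
    ring
  have hxu : x = 3 * π / 2 - u := by rw [hu]; ring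
  rw [hsin]
  have hu0 : 0 ≤ u := by linarith
  rcases le_total u 1 with h1 | h1
  · have hb := (abs_le.1 (Real.cos_bound (x := u) (by rw [abs_of_nonneg hu0]; exact h1))).2
    rw [abs_of_nonneg hu0] at hb
    have hq : u ^ 4 * (5 / 96) + 0.2173 * u ≤ u ^ 2 / 2 + 0.0239 := by
      rcases le_total u 0.3 with h3 | h3
      · have : u ^ 2 ≤ 0.09 := by nlinarith
        nlinarith [mul_le_mul_of_nonneg_right this (sq_nonneg u), sq_nonneg (u - 0.2193)]
      rcases le_total u 0.5 with h5 | h5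
      · have : u ^ 2 ≤ 0.25 := by nlinarith
        nlinarith [mul_le_mul_of_nonneg_right this (sq_nonneg u)]
      · have : u ^ 2 ≤ 1 := by nlinarith
        nlinarith [mul_le_mul_of_nonneg_right this (sq_nonneg u)]
    linarith
  · have hc : cos u ≤ cos 1 := cos_le_cos_of_nonneg_of_le_pi (by norm_num) (by linarith) h1
    have := cos_one_le
    linarith

theorem coeff_one_add_X_mul_nonneg {A : PowerSeries ℝ} (hA : ∀ n, 0 ≤ coeff n A) (n : ℕ) :
    0 ≤ coeff n ((1 + X) * A) := by
  rw [add_mul, one_mul, map_add]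
  cases n with
  | zero => simpa using hA 0
  | succ n =>
    rw [coeff_succ_X_mul]
    exact add_nonneg (hA _) (hA _)

theorem quadSeries_eq {s c : ℝ} {x : ℝ} (hsc : s ^ 2 + c ^ 2 = 1) (hx : x = 1 - 2 * s ^ 2) :
    quadSeries x = C (s ^ 2) * (1 + X) ^ 2 + C (c ^ 2) * (1 - X) ^ 2 := by
  have h1 : C (s ^ 2) + C (c ^ 2) = (1 : PowerSeries ℝ) := by
    rw [← map_add, hsc, map_one]
  have h2 : (C (2 * x) : PowerSeries ℝ) = 2 * (C (c ^ 2) - C (s ^ 2)) := by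
    have : 2 * x = c ^ 2 - s ^ 2 + (c ^ 2 - s ^ 2) := by rw [hx]; linarith
    rw [this, map_add, map_sub]; ring
  rw [quadSeries, h2]
  linear_combination (-1 - X ^ 2) * h1

/-- The series `(1 + z) / ((1 - z) √(1 - 2 z x + z²))`. -/
noncomputable def rootSeries (x : ℝ) : PowerSeries ℝ :=
  (1 + X) * (legendreSeries x * geomSeries)

theorem coeff_rootSeries_nonneg (θ : ℝ) (n : ℕ) : 0 ≤ coeff n (rootSeries (cos θ)) :=
  coeff_one_add_X_mul_nonneg (coeff_legendreSeries_mul_geomSeries_nonneg θ) n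

theorem sq_mul_rootSeries_sq {s c x : ℝ} (hsc : s ^ 2 + c ^ 2 = 1) (hx : x = 1 - 2 * s ^ 2) :
    C (s ^ 2) * rootSeries x ^ 2 = geomSeries ^ 2 - C (c ^ 2) * legendreSeries x ^ 2 := by
  have h1 := quadSeries_eq hsc hx
  have h2 := legendreSeries_sq_mul_quadSeries x
  have h3 := geomSeries_mul
  rw [h1] at h2
  rw [rootSeries]
  linear_combination geomSeries ^ 2 * h2 -
    C (c ^ 2) * legendreSeries x ^ 2 * (geomSeries * (1 - X) + 1) * h3

section Bounds

variable {θ : ℝ}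

theorem cos_eq_one_sub_sin_half_sq (θ : ℝ) : cos θ = 1 - 2 * sin (θ / 2) ^ 2 := by
  have h := cos_two_mul (θ / 2)
  rw [mul_div_cancel₀ θ two_ne_zero] at h
  linarith [sin_sq_add_cos_sq (θ / 2)]

theorem neg_cos_half_sq_mul_coeff_le (hθ : 0 < θ) (hθ' : θ ≤ π) (n : ℕ) :
    -(cos (θ / 2) ^ 2 * coeff n (legendreSeries (cos θ) ^ 2)) ≤ 0.2173 * (n + 1) := by
  have hs : 0 < sin (θ / 2) := sin_pos_of_pos_of_lt_pi (by linarith) (by linarith)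
  have hc : 0 ≤ cos (θ / 2) := cos_nonneg_of_mem_Icc ⟨by linarith, by linarith⟩
  rcases hc.eq_or_lt with h0 | hc
  · rw [← h0]
    norm_num
    positivity
  have hU := sin_mul_coeff_legendreSeries_sq θ n
  set u := coeff n (legendreSeries (cos θ) ^ 2)
  have hlt : θ / 2 < π / 2 := by
    refine lt_of_le_of_ne (by linarith) fun h => ?_
    rw [h, cos_pi_div_two] at hc
    exact lt_irrefl _ hc
  have htan := Real.lt_tan (by linarith : 0 < θ / 2) hlt
  rw [tan_eq_sin_div_cos, lt_div_iff₀ hc] at htan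
  have hsin : sin θ = 2 * sin (θ / 2) * cos (θ / 2) := by
    rw [← sin_two_mul, mul_div_cancel₀ θ two_ne_zero]
  rw [hsin] at hU
  have hN := neg_sin_le_mul (x := (n + 1) * θ) (by positivity)
  rw [← hU] at hN
  have key : (2 * sin (θ / 2)) * (-(cos (θ / 2) ^ 2 * u)) ≤
      (2 * sin (θ / 2)) * (0.2173 * (n + 1)) := by
    calc (2 * sin (θ / 2)) * (-(cos (θ / 2) ^ 2 * u))
        = -(2 * sin (θ / 2) * cos (θ / 2) * u) * cos (θ / 2) := by ring
      _ ≤ 0.2173 * ((n + 1) * θ) * cos (θ / 2) := by gcongr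
      _ = 0.2173 * (n + 1) * 2 * (θ / 2 * cos (θ / 2)) := by ring
      _ ≤ 0.2173 * (n + 1) * 2 * sin (θ / 2) := by gcongr
      _ = _ := by ring
  exact le_of_mul_le_mul_left key (by positivity)

theorem coeff_rootSeries_sq_le (hθ : 0 < θ) (hθ' : θ ≤ π) (n : ℕ) :
    coeff n (rootSeries (cos θ) ^ 2) ≤
      coeff n (C (1.2173 / sin (θ / 2) ^ 2) * geomSeries ^ 2) := by
  have hs : 0 < sin (θ / 2) := sin_pos_of_pos_of_lt_pi (by linarith) (by linarith)
  have h := congrArg (coeff n) (sq_mul_rootSeries_sq (sin_sq_add_cos_sq (θ / 2))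
    (cos_eq_one_sub_sin_half_sq θ))
  have h2 := neg_cos_half_sq_mul_coeff_le hθ hθ' n
  have h3 := coeff_geomSeries_pow 1 n
  rw [Nat.choose_one_right] at h3
  rw [map_sub, coeff_C_mul, coeff_C_mul, h3] at h
  rw [coeff_C_mul, h3, div_mul_eq_mul_div, le_div_iff₀ (by positivity), mul_comm, h]
  push_cast at h2 ⊢
  linarith

theorem coeff_rootSeries_mul_geomSeries_le (hθ : 0 < θ) (hθ' : θ ≤ π) (n : ℕ) :
    coeff n (rootSeries (cos θ) * geomSeries) ≤ 2 * (n + 1) / sin (θ / 2) := by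
  have hs : 0 < sin (θ / 2) := sin_pos_of_pos_of_lt_pi (by linarith) (by linarith)
  set h := rootSeries (cos θ) with hh
  have hnn : ∀ m, 0 ≤ coeff m h := coeff_rootSeries_nonneg θ
  have hmono : coeff n (h * geomSeries) ^ 2 ≤ coeff (2 * n) (h ^ 2 * geomSeries) := by
    have : h ^ 2 * geomSeries = h * (h * geomSeries) := by ring
    rw [this, coeff_mul (2 * n), Finset.Nat.sum_antidiagonal_eq_sum_range_succ_mk]
    calc coeff n (h * geomSeries) ^ 2
        = ∑ j ∈ range (n + 1), coeff j h * coeff n (h * geomSeries) := by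
          rw [← Finset.sum_mul, ← coeff_mul_geomSeries, sq]
      _ ≤ ∑ j ∈ range (n + 1), coeff j h * coeff (2 * n - j) (h * geomSeries) := by
          refine Finset.sum_le_sum fun j hj => mul_le_mul_of_nonneg_left ?_ (hnn j)
          rw [coeff_mul_geomSeries, coeff_mul_geomSeries]
          refine Finset.sum_le_sum_of_subset_of_nonneg ?_ fun i _ _ => hnn i
          rw [Finset.range_subset_range]
          rw [Finset.mem_range] at hj
          omega
      _ ≤ _ := by
          refine Finset.sum_le_sum_of_subset_of_nonneg ?_ fun i _ _ =>
            mul_nonneg (hnn i) (coeff_mul_nonneg hnn coeff_geomSeries_nonneg _)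
          rw [Finset.range_subset_range]
          omega
  have hbound : coeff (2 * n) (h ^ 2 * geomSeries) ≤
      1.2173 / sin (θ / 2) ^ 2 * ((n + 1) * (2 * n + 1)) := by
    refine (coeff_mul_le_coeff_mul (coeff_rootSeries_sq_le hθ hθ') coeff_geomSeries_nonneg
      (2 * n)).trans_eq ?_
    have h3 := coeff_geomSeries_pow 2 (2 * n)
    rw [mul_assoc, ← pow_succ, coeff_C_mul, h3, Nat.cast_choose_two]
    push_cast
    ring
  refine (pow_le_pow_iff_left₀ (coeff_mul_nonneg hnn coeff_geomSeries_nonneg n)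
    (by positivity) two_ne_zero).1 ?_
  refine (hmono.trans hbound).trans ?_
  rw [div_pow, div_mul_eq_mul_div]
  gcongr
  nlinarith [(n.cast_nonneg : (0 : ℝ) ≤ n)]

theorem legendreSeries_cube (x : ℝ) :
    C (1 - x) * ((1 + X) * legendreSeries x ^ 3) =
      legendreSeries x + X * derivative ℝ (legendreSeries x) - derivative ℝ (legendreSeries x) := by
  have h1 := legendreSeries_sq_mul_quadSeries x
  have h2 := quadSeries_mul_derivative_legendreSeries x
  have h3 : (C (2 * x) : PowerSeries ℝ) = 2 * C x := by
    rw [map_mul]; rfl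
  have h4 : quadSeries x = 1 - 2 * C x * X + X ^ 2 := by rw [quadSeries, h3]
  rw [map_sub, map_one]
  set p := legendreSeries x
  set d := derivative ℝ p
  linear_combination (p + X * d - d) * h1 - p ^ 2 * (X - 1) * h2 - p ^ 3 * h4

theorem neg_coeff_legendreSeries_cube_le (hθ : 0 < θ) (hθ' : θ ≤ π) (n : ℕ) :
    -(cos (θ / 2) ^ 2 * coeff n ((1 + X) * legendreSeries (cos θ) ^ 3)) ≤
      2 * (n + 1) / sin (θ / 2) := by
  have hs : 0 < sin (θ / 2) := sin_pos_of_pos_of_lt_pi (by linarith) (by linarith)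
  have hc : 0 ≤ cos (θ / 2) := cos_nonneg_of_mem_Icc ⟨by linarith, by linarith⟩
  have hx := cos_eq_one_sub_sin_half_sq θ
  have h := congrArg (coeff n) (legendreSeries_cube (cos θ))
  have hd : coeff n (X * derivative ℝ (legendreSeries (cos θ))) = n * legendre (cos θ) n := by
    cases n with
    | zero => simp
    | succ n =>
      rw [coeff_succ_X_mul, coeff_derivative, legendreSeries, coeff_mk]
      push_cast
      ring
  rw [coeff_C_mul, map_sub, map_add, hd, coeff_derivative, legendreSeries, coeff_mk, coeff_mk,
    ← legendreSeries] at h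
  have h1 : 1 - cos θ = 2 * sin (θ / 2) ^ 2 := by linarith
  rw [h1] at h
  have h2 := sq_mul_legendre_sub_le hs hc (sin_sq_add_cos_sq (θ / 2)) hx n
  set v := coeff n ((1 + X) * legendreSeries (cos θ) ^ 3)
  rw [le_div_iff₀ hs]
  have h3 : 0 < 2 * sin (θ / 2) := by positivity
  refine le_of_mul_le_mul_left ?_ h3
  calc 2 * sin (θ / 2) * (-(cos (θ / 2) ^ 2 * v) * sin (θ / 2))
      = -(cos (θ / 2) ^ 2 * (2 * sin (θ / 2) ^ 2 * v)) := by ring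
    _ = (n + 1) * (cos (θ / 2) ^ 2 * (legendre (cos θ) (n + 1) - legendre (cos θ) n)) := by
        rw [h]; ring
    _ ≤ (n + 1) * (4 * sin (θ / 2)) := by gcongr
    _ = _ := by ring

/-- The kernel series `(1 + z)^(2k+3) / ((1 - 2 z x + z²)^(k+3/2) (1 - z)^(2k+2))`. -/
noncomputable def kernelSeries (x : ℝ) (k : ℕ) : PowerSeries ℝ :=
  (1 + X) ^ (2 * k + 3) * legendreSeries x ^ (2 * k + 3) * geomSeries ^ (2 * k + 2)

theorem coeff_kernelSeries_zero_le (hθ : 0 < θ) (hθ' : θ ≤ π) (n : ℕ) :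
    coeff n (kernelSeries (cos θ) 0) ≤ coeff n (C (4 / sin (θ / 2) ^ 3) * geomSeries ^ 2) := by
  have hs : 0 < sin (θ / 2) := sin_pos_of_pos_of_lt_pi (by linarith) (by linarith)
  have hk : C (sin (θ / 2) ^ 2) * kernelSeries (cos θ) 0 =
      rootSeries (cos θ) * geomSeries -
        C (cos (θ / 2) ^ 2) * ((1 + X) * legendreSeries (cos θ) ^ 3) := by
    have h := sq_mul_rootSeries_sq (sin_sq_add_cos_sq (θ / 2)) (cos_eq_one_sub_sin_half_sq θ)
    rw [kernelSeries]
    rw [rootSeries] at h ⊢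
    linear_combination ((1 + X) * legendreSeries (cos θ)) * h
  have h := congrArg (coeff n) hk
  rw [coeff_C_mul, map_sub, coeff_C_mul] at h
  have h1 := coeff_rootSeries_mul_geomSeries_le hθ hθ' n
  have h2 := neg_coeff_legendreSeries_cube_le hθ hθ' n
  have h3 := coeff_geomSeries_pow 1 n
  rw [Nat.choose_one_right] at h3
  rw [coeff_C_mul, h3]
  refine le_of_mul_le_mul_left ?_ (by positivity : 0 < sin (θ / 2) ^ 2)
  have h4 : sin (θ / 2) ^ 2 * (4 / sin (θ / 2) ^ 3 * ((1 + n : ℕ) : ℝ)) =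
      2 * (n + 1) / sin (θ / 2) + 2 * (n + 1) / sin (θ / 2) := by
    push_cast
    field_simp
    ring
  rw [h, h4]
  linarith

theorem coeff_rootSeries_sq_pow_le (hθ : 0 < θ) (hθ' : θ ≤ π) (k n : ℕ) :
    coeff n ((rootSeries (cos θ) ^ 2) ^ k) ≤
      coeff n ((C (1.2173 / sin (θ / 2) ^ 2) * geomSeries ^ 2) ^ k) := by
  have hnn := coeff_pow_nonneg (coeff_rootSeries_nonneg θ) 2
  have hge := fun m => (hnn m).trans (coeff_rootSeries_sq_le hθ hθ' m)
  induction k generalizing n with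
  | zero => simp
  | succ k ih =>
    rw [pow_succ]
    refine (coeff_mul_le_coeff_mul ih hnn n).trans ?_
    rw [mul_comm, pow_succ' (C _ * _)]
    refine coeff_mul_le_coeff_mul (coeff_rootSeries_sq_le hθ hθ') (coeff_pow_nonneg hge k) n

theorem coeff_kernelSeries_le (hθ : 0 < θ) (hθ' : θ ≤ π) (k n : ℕ) :
    coeff n (kernelSeries (cos θ) k) ≤
      4 * (1.2173 : ℝ) ^ k * ((n + 2 * k + 1).choose n : ℝ) / sin (θ / 2) ^ (2 * k + 3) := by
  have hs : 0 < sin (θ / 2) := sin_pos_of_pos_of_lt_pi (by linarith) (by linarith)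
  have h1 : kernelSeries (cos θ) k = kernelSeries (cos θ) 0 * (rootSeries (cos θ) ^ 2) ^ k := by
    rw [kernelSeries, kernelSeries, rootSeries]
    generalize (1 + X : PowerSeries ℝ) = v
    ring
  rw [h1]
  refine (coeff_mul_le_coeff_mul (coeff_kernelSeries_zero_le hθ hθ')
    (coeff_pow_nonneg (coeff_pow_nonneg (coeff_rootSeries_nonneg θ) 2) k) n).trans ?_
  rw [mul_comm]
  have h2 : ∀ m, 0 ≤ coeff m (C (4 / sin (θ / 2) ^ 3) * geomSeries ^ 2) := fun m => by
    rw [coeff_C_mul]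
    exact mul_nonneg (by positivity) (coeff_pow_nonneg coeff_geomSeries_nonneg 2 m)
  refine (coeff_mul_le_coeff_mul (coeff_rootSeries_sq_pow_le hθ hθ' k) h2 n).trans_eq ?_
  have h3 : (C (1.2173 / sin (θ / 2) ^ 2) * geomSeries ^ 2) ^ k *
      (C (4 / sin (θ / 2) ^ 3) * geomSeries ^ 2) =
      C ((1.2173 / sin (θ / 2) ^ 2) ^ k * (4 / sin (θ / 2) ^ 3)) *
        geomSeries ^ (2 * k + 1 + 1) := by
    rw [map_mul, map_pow]
    ring
  have h4 : (n + 2 * k + 1).choose n = (2 * k + 1 + n).choose (2 * k + 1) := by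
    rw [show n + 2 * k + 1 = 2 * k + 1 + n by ring, Nat.choose_symm_add]
  rw [h3, coeff_C_mul, coeff_geomSeries_pow, h4, div_pow, ← pow_mul, pow_add _ (2 * k) 3]
  field_simp

end Bounds

/-- The formal power series `A` converges to `f` on the interval `|z| < r`. -/
def ConvergesTo (r : ℝ) (A : PowerSeries ℝ) (f : ℝ → ℝ) : Prop :=
  ∀ z : ℝ, |z| < r → HasSum (fun m => coeff m A * z ^ m) (f z)

namespace ConvergesTo

variable {r : ℝ} {A B : PowerSeries ℝ} {f g : ℝ → ℝ}

theorem mul (hA : ConvergesTo r A f) (hB : ConvergesTo r B g) :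
    ConvergesTo r (A * B) (fun z => f z * g z) := by
  intro z hz
  have h := hasSum_sum_range_mul_of_summable_norm (hA z hz).summable.norm (hB z hz).summable.norm
  rw [(hA z hz).tsum_eq, (hB z hz).tsum_eq] at h
  have hfun : ∀ m, coeff m (A * B) * z ^ m =
      ∑ i ∈ range (m + 1), coeff i A * z ^ i * (coeff (m - i) B * z ^ (m - i)) := fun m => by
    rw [coeff_mul, Finset.Nat.sum_antidiagonal_eq_sum_range_succ_mk, Finset.sum_mul]
    refine Finset.sum_congr rfl fun i hi => ?_
    rw [Finset.mem_range] at hi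
    have hm : z ^ m = z ^ i * z ^ (m - i) := by
      rw [← pow_add, Nat.add_sub_cancel' (by omega)]
    rw [hm]
    ring
  simpa only [hfun] using h

theorem one : ConvergesTo r 1 (fun _ => 1) := by
  intro z _
  convert hasSum_single (f := fun m => coeff m (1 : PowerSeries ℝ) * z ^ m) 0 ?_ using 1
  · simp
  · intro m hm
    simp [coeff_one, hm]

theorem pow (hA : ConvergesTo r A f) (k : ℕ) : ConvergesTo r (A ^ k) (fun z => f z ^ k) := by
  induction k with
  | zero => simpa using one
  | succ k ih => simpa only [pow_succ] using ih.mul hA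

theorem add (hA : ConvergesTo r A f) (hB : ConvergesTo r B g) :
    ConvergesTo r (A + B) (fun z => f z + g z) := by
  intro z hz
  simpa only [map_add, add_mul] using (hA z hz).add (hB z hz)

theorem sub (hA : ConvergesTo r A f) (hB : ConvergesTo r B g) :
    ConvergesTo r (A - B) (fun z => f z - g z) := by
  intro z hz
  simpa only [map_sub, sub_mul] using (hA z hz).sub (hB z hz)

theorem const_mul (hA : ConvergesTo r A f) (t : ℝ) :
    ConvergesTo r (C t * A) (fun z => t * f z) := by
  intro z hz
  simpa only [coeff_C_mul, mul_assoc] using (hA z hz).mul_left t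

theorem X : ConvergesTo r PowerSeries.X (fun z => z) := by
  intro z _
  convert hasSum_single (f := fun m => coeff m (PowerSeries.X : PowerSeries ℝ) * z ^ m) 1 ?_ using 1
  · simp
  · intro m hm
    simp [coeff_X, hm]

theorem unique (hr : 0 < r) (hA : ConvergesTo r A f) (hB : ConvergesTo r B g)
    (hfg : ∀ z, |z| < r → f z = g z) : A = B := by
  have key : ∀ D : PowerSeries ℝ, ConvergesTo r D f → HasFPowerSeriesAt f
      (FormalMultilinearSeries.ofScalars ℝ fun m => coeff m D) 0 := by
    intro D hD
    rw [hasFPowerSeriesAt_iff]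
    filter_upwards [Metric.ball_mem_nhds (0 : ℝ) hr] with z hz
    rw [Metric.mem_ball, dist_zero_right, Real.norm_eq_abs] at hz
    simpa [mul_comm] using hD z hz
  have hB' : ConvergesTo r B f := fun z hz => by
    rw [hfg z hz]
    exact hB z hz
  have h := (key A hA).eq_formalMultilinearSeries (key B hB')
  ext m
  have hm := congrArg (fun p => FormalMultilinearSeries.coeff p m) h
  simpa using hm

end ConvergesTo

theorem eq_kernelSeries {θ r : ℝ} (hr : 0 < r) {A : PowerSeries ℝ} {k : ℕ}
    (hA : ConvergesTo r A fun z => (1 + z) ^ (2 * k + 3) /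
      ((1 - 2 * z * cos θ + z ^ 2) ^ ((k : ℝ) + 3 / 2) * (1 - z) ^ (2 * k + 2))) :
    A = kernelSeries (cos θ) k := by
  have h1 : ConvergesTo (min r 1) A _ := fun z hz => hA z (hz.trans_le (min_le_left _ _))
  have hQ : ConvergesTo (min r 1) (quadSeries (cos θ)) _ :=
    (ConvergesTo.one.sub (ConvergesTo.X.const_mul (2 * cos θ))).add (ConvergesTo.X.pow 2)
  have hleft := ((h1.pow 2).mul (hQ.pow (2 * k + 3))).mul
    (((ConvergesTo.one.sub ConvergesTo.X).pow (2 * k + 2)).pow 2)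
  have hright : ConvergesTo (min r 1) _ _ :=
    (((ConvergesTo.one.add ConvergesTo.X).pow (2 * k + 3)).pow 2)
  have hsq := hleft.unique (lt_min hr one_pos) hright fun z hz => by
    have hz1 : |z| < 1 := hz.trans_le (min_le_right _ _)
    rw [abs_lt] at hz1
    have hq : 0 < 1 - 2 * z * cos θ + z ^ 2 := by
      rcases le_total 0 z with h0 | h0
      · nlinarith [cos_le_one θ, mul_pos (sub_pos.2 hz1.2) (sub_pos.2 hz1.2)]
      · nlinarith [neg_one_le_cos θ, mul_pos (neg_lt_iff_pos_add.1 hz1.1) (neg_lt_iff_pos_add.1 hz1.1)]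
    have hz2 : (1 - z) ≠ 0 := by linarith
    have hpow : ((1 - 2 * z * cos θ + z ^ 2) ^ ((k : ℝ) + 3 / 2)) ^ 2 =
        (1 - 2 * z * cos θ + z ^ 2) ^ (2 * k + 3) := by
      have he : ((k : ℝ) + 3 / 2) * (2 : ℕ) = (2 * k + 3 : ℕ) := by
        push_cast
        ring
      rw [← Real.rpow_mul_natCast hq.le, he, Real.rpow_natCast]
    have hq' : 1 - 2 * cos θ * z + z ^ 2 = 1 - 2 * z * cos θ + z ^ 2 := by ring
    simp only [hq', div_pow, mul_pow, hpow]
    have hq2 := (pow_pos hq (2 * k + 3)).ne'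
    generalize (1 - 2 * z * cos θ + z ^ 2) ^ (2 * k + 3) = q at hq2 ⊢
    field_simp
  have hker : kernelSeries (cos θ) k ^ 2 * quadSeries (cos θ) ^ (2 * k + 3) *
      ((1 - X) ^ (2 * k + 2)) ^ 2 = ((1 + X) ^ (2 * k + 3)) ^ 2 := by
    have e : kernelSeries (cos θ) k ^ 2 * quadSeries (cos θ) ^ (2 * k + 3) *
        ((1 - X) ^ (2 * k + 2)) ^ 2 = ((1 + X) ^ (2 * k + 3)) ^ 2 *
        (legendreSeries (cos θ) ^ 2 * quadSeries (cos θ)) ^ (2 * k + 3) *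
        ((geomSeries * (1 - X)) ^ (2 * k + 2)) ^ 2 := by
      rw [kernelSeries]
      generalize (1 + X : PowerSeries ℝ) = v
      generalize (1 - X : PowerSeries ℝ) = w
      ring
    rw [e, legendreSeries_sq_mul_quadSeries, geomSeries_mul]
    simp
  have hQ0 : quadSeries (cos θ) ≠ 0 := fun h => by
    have := legendreSeries_sq_mul_quadSeries (cos θ)
    simp [h] at this
  have hX0 : (1 - X : PowerSeries ℝ) ≠ 0 := fun h => by
    have := geomSeries_mul
    simp [h] at this
  have hAA : A ^ 2 = kernelSeries (cos θ) k ^ 2 :=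
    mul_right_cancel₀ (pow_ne_zero _ hQ0)
      (mul_right_cancel₀ (pow_ne_zero _ (pow_ne_zero _ hX0)) (hsq.trans hker.symm))
  have hA0 : constantCoeff A = 1 := by
    have h := hA 0 (by simpa using hr)
    have h' := h.unique (hasSum_single (f := fun m => coeff m A * (0 : ℝ) ^ m) 0 fun m hm => by
      simp [hm])
    simpa using h'.symm
  rcases sq_eq_sq_iff_eq_or_eq_neg.1 hAA with h | h
  · exact h
  · have := congrArg constantCoeff h
    rw [hA0] at this
    simp [kernelSeries, legendreSeries, geomSeries, legendre] at this
    norm_num at this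

end HalfIntegerKernel

/-- Half-integer case of Theorem 2: if
Σ aₘ zᵐ = (1+z)^{2k+3}/((1−2z·cos θ+z²)^{k+3/2}·(1−z)^{2k+2}) for all |z| < ε, then
aₙ ≤ 4·(1.2173)^k·C(n+2k+1, n)/(sin(θ/2))^{2k+3}. -/
theorem new_kernel_half_integer_bound (θ : ℝ) (hθ : 0 < θ) (hθ' : θ ≤ Real.pi)
    (k n : ℕ) (a : ℕ → ℝ) (ε : ℝ) (hε : 0 < ε)
    (ha : ∀ z : ℝ, |z| < ε →
      HasSum (fun m : ℕ => a m * z ^ m)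
        ((1 + z) ^ (2 * k + 3) /
          ((1 - 2 * z * Real.cos θ + z ^ 2) ^ ((k : ℝ) + 3 / 2) * (1 - z) ^ (2 * k + 2)))) :
    a n ≤ 4 * (1.2173 : ℝ) ^ k * ((n + 2 * k + 1).choose n : ℝ) /
        Real.sin (θ / 2) ^ (2 * k + 3) := by
  have hA : PowerSeries.mk a = HalfIntegerKernel.kernelSeries (Real.cos θ) k :=
    HalfIntegerKernel.eq_kernelSeries hε fun z hz => by
      simpa only [PowerSeries.coeff_mk] using ha z hz
  rw [← PowerSeries.coeff_mk n a, hA]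
  exact HalfIntegerKernel.coeff_kernelSeries_le hθ hθ' k n
end
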